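/- arXiv:0710.0152 — 3 statements merged into one kernel-verified Lean document; each statement's English description precedes it below -/
import Mathlib

section
/- If S ⊆ ω is infinite with 0 ∈ S and satisfies condition (M), then S satisfies condition (H). In particular, condition (M) implies that A^S is ≤ʳ_c-minimal among non-pot(Π⁰₁) Borel sets. -/
open Set Topology

abbrev Cantor : Type := ℕ → Bool

/-- `A ⊆ X × Y` is potentially closed (`pot(Π⁰₁)`): there are finer Polish topologies on `X`
and `Y` making `A` closed in the product. -/
def PotClosed {X Y : Type} (tX : TopologicalSpace X) (tY : TopologicalSpace Y)
    (A : Set (X × Y)) : Prop :=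
  ∃ (σ : TopologicalSpace X) (τ : TopologicalSpace Y),
    σ ≤ tX ∧ τ ≤ tY ∧ @PolishSpace X σ ∧ @PolishSpace Y τ ∧
    @IsClosed (X × Y) (@instTopologicalSpaceProd X Y σ τ) A

/-- Membership in the class `D₂(Σ⁰₁)`: difference of two open sets. -/
def D2Sigma01 {Z : Type} (t : TopologicalSpace Z) (A : Set Z) : Prop :=
  ∃ U V : Set Z, @IsOpen Z t U ∧ @IsOpen Z t V ∧ A = U \ V

/-- The rectangular continuous reducibility `A ≤ʳ_c A'`. -/
def RedRC {X Y X' Y' : Type} (tX : TopologicalSpace X) (tY : TopologicalSpace Y)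
    (tX' : TopologicalSpace X') (tY' : TopologicalSpace Y')
    (A : Set (X × Y)) (A' : Set (X' × Y')) : Prop :=
  ∃ (u : X → X') (v : Y → Y'),
    @Continuous X X' tX tX' u ∧ @Continuous Y Y' tY tY' v ∧
    A = (fun p => (u p.1, v p.2)) ⁻¹' A'

/-- `≤ʳ_c` on subsets of `Cantor × Cantor` with the standard topology. -/
def RedC2 (A A' : Set (Cantor × Cantor)) : Prop :=
  RedRC inferInstance inferInstance inferInstance inferInstance A A'

/-- `A` is `≤ʳ_c`-minimal among non-potentially closed Borel sets. -/
def MinNonPotClosed {X Y : Type} (tX : TopologicalSpace X) (tY : TopologicalSpace Y)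
    (A : Set (X × Y)) : Prop :=
  ¬ PotClosed tX tY A ∧
  ∀ (X' Y' : Type) (tX' : TopologicalSpace X') (tY' : TopologicalSpace Y'),
    @PolishSpace X' tX' → @PolishSpace Y' tY' →
    ∀ A' : Set (X' × Y'),
      @MeasurableSet (X' × Y') (@borel (X' × Y') (@instTopologicalSpaceProd X' Y' tX' tY')) A' →
      ¬ PotClosed tX' tY' A' →
      RedRC tX' tY' tX tY A' A → RedRC tX tY tX' tY' A A'

/-- The Borel reducibility `A ≤_B A'` for square sets. -/
def RedB {Z Z' : Type} (tZ : TopologicalSpace Z) (tZ' : TopologicalSpace Z')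
    (A : Set (Z × Z)) (A' : Set (Z' × Z'))  : Prop :=
  ∃ u : Z → Z', @Measurable Z Z' (@borel Z tZ) (@borel Z' tZ') u ∧
    A = (fun p => (u p.1, u p.2)) ⁻¹' A'

/-- `A` is `≤_B`-minimal among non-potentially closed Borel (square) sets. -/
def MinBNonPotClosed {Z : Type} (tZ : TopologicalSpace Z) (A : Set (Z × Z)) : Prop :=
  ¬ PotClosed tZ tZ A ∧
  ∀ (Z' : Type) (tZ' : TopologicalSpace Z'), @PolishSpace Z' tZ' →
    ∀ A' : Set (Z' × Z'),
      @MeasurableSet (Z' × Z') (@borel (Z' × Z') (@instTopologicalSpaceProd Z' Z' tZ' tZ')) A' →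
      ¬ PotClosed tZ' tZ' A' →
      RedB tZ' tZ A' A → RedB tZ tZ' A A'

/-- The graph of the partial function `f` with domain `D`. -/
def graphRel {X : Type} (D : Set X) (f : X → X) : Set (X × X) :=
  {p | p.1 ∈ D ∧ p.2 = f p.1}

/-- `A^f := ⋃ₙ Graph(fₙ)`. -/
def unionGraphs {X : Type} (D : ℕ → Set X) (f : ℕ → X → X) : Set (X × X) :=
  ⋃ n, graphRel (D n) (f n)

/-- `f` restricted to `D` is a partial homeomorphism with clopen domain and clopen range. -/
def IsPartialHomeo {X : Type} (t : TopologicalSpace X) (D : Set X) (f : X → X) : Prop :=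
  @IsClopen X t D ∧ @IsClopen X t (f '' D) ∧ @ContinuousOn X X t t f D ∧
    ∃ g : X → X, @ContinuousOn X X t t g (f '' D) ∧ ∀ x ∈ D, g (f x) = x

/-- A converging situation: a nonempty zero-dimensional perfect Polish space together with
partial homeomorphisms with clopen domains and ranges such that
`Δ(X) = closure(A^f) \ A^f`. -/
def ConvSit (X : Type) (t : TopologicalSpace X) (D : ℕ → Set X) (f : ℕ → X → X) : Prop :=
  Nonempty X ∧ @PolishSpace X t ∧
  @TopologicalSpace.IsTopologicalBasis X t {s : Set X | @IsClopen X t s} ∧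
  @Perfect X t Set.univ ∧
  (∀ n, IsPartialHomeo t (D n) (f n)) ∧
  Set.diagonal X =
    @closure (X × X) (@instTopologicalSpaceProd X X t t) (unionGraphs D f) \ unionGraphs D f

/-- The domain of the restriction `f^B` of the partial map `(D, f)` to a subset `B`. -/
def subD {X : Type} (B : Set X) (D : Set X) (f : X → X) : Set ↥B :=
  {x | (x : X) ∈ D ∧ f (x : X) ∈ B}

/-- The restriction `f^B` of `f` to `B`, as a map of the subtype (junk value outside). -/
noncomputable def subF {X : Type} (B : Set X) (f : X → X) : ↥B → ↥B :=
  fun x =>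
    letI := Classical.dec (f (x : X) ∈ B)
    if h : f (x : X) ∈ B then ⟨f (x : X), h⟩ else x

/-- `A^f ∩ B²`, viewed on the subtype `B`: the union of the graphs of the `f^B_n`'s. -/
def restrGraphs {X : Type} (B : Set X) (D : ℕ → Set X) (f : ℕ → X → X) : Set (↥B × ↥B) :=
  unionGraphs (fun n => subD B (D n) (f n)) (fun n => subF B (f n))

/-- The subspace topology on `B` induced by a topology `t` on `X`. -/
def subTop {X : Type} (t : TopologicalSpace X) (B : Set X) : TopologicalSpace ↥B :=
  @TopologicalSpace.induced ↥B X Subtype.val t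

/-- The natural bijection `ψ : ω → 2^{<ω}` (enumeration by length, then lexicographically):
`ψ(n)` is the binary expansion of `n+1` with its leading one removed. -/
def psiSeq (n : ℕ) : List Bool := ((n + 1).bits.dropLast).reverse

/-- `s_n := ψ(n)0^{n-|ψ(n)|}`, a dense sequence with `|s_n| = n`. -/
def sSeq (n : ℕ) : List Bool := psiSeq n ++ List.replicate (n - (psiSeq n).length) false

/-- The concatenation `sγ` of a finite sequence `s` with `γ ∈ 2^ω`. -/
def catSeq (s : List Bool) (γ : Cantor) : Cantor :=
  fun i => if h : i < s.length then s.get ⟨i, h⟩ else γ (i - s.length)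

/-- `A₁ := {(s_n0γ, s_n1γ) : n ∈ ω, γ ∈ 2^ω}`. -/
def A1 : Set (Cantor × Cantor) :=
  {p | ∃ (n : ℕ) (γ : Cantor),
    p.1 = catSeq (sSeq n ++ [false]) γ ∧ p.2 = catSeq (sSeq n ++ [true]) γ}

/-- `Card(x↾n)`: the number of ones among the first `n` coordinates of `x`. -/
def cardOnes (x : Cantor) (n : ℕ) : ℕ := ∑ i ∈ Finset.range n, (if x i then 1 else 0)

/-- The domain of `f^S_n`: sequences vanishing at `n` whose first `n` coordinates contain a
number of ones belonging to `S`. -/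
def DSdom (S : Set ℕ) (n : ℕ) : Set Cantor := {x | x n = false ∧ cardOnes x n ∈ S}

/-- `f^S_n (s0γ) := s1γ`: flip the `n`-th coordinate to one. -/
def fSfun (n : ℕ) : Cantor → Cantor := fun x => Function.update x n true

/-- `A^S := {(s0γ, s1γ) : s ∈ 2^{<ω}, Card(s) ∈ S, γ ∈ 2^ω} = ⋃ₙ Graph(f^S_n)`. -/
def ASet (S : Set ℕ) : Set (Cantor × Cantor) := unionGraphs (DSdom S) fSfun

/-- Condition (M) on `S ⊆ ω`. -/
def CondM (S : Set ℕ) : Prop :=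
  ∀ p : ℕ, ∃ k : ℕ, ∀ q : ℕ, ∃ c : ℕ, q ≤ c ∧ c ≤ q + k ∧
    (fun m => c + m) '' (S ∩ Set.Iic p) = S ∩ Set.Icc c (c + p)

/-- Condition (H) on `S ⊆ ω`. -/
def CondH (S : Set ℕ) : Prop :=
  ∀ C : Set Cantor, @MeasurableSet Cantor (borel Cantor) C →
    ∀ σ : TopologicalSpace ↥C, σ ≤ subTop inferInstance C →
      ConvSit ↥C σ (fun n => subD C (DSdom S n) (fSfun n)) (fun n => subF C (fSfun n)) →
      ∀ l p : ℕ, ∃ n : ℕ, l ≤ n ∧ ∃ γ : ↥C, γ ∈ subD C (DSdom S n) (fSfun n) ∧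
        (fun m => cardOnes (γ : Cantor) n + m) '' (S ∩ Set.Iic p) =
          S ∩ Set.Icc (cardOnes (γ : Cantor) n) (cardOnes (γ : Cantor) n + p)

/-- Condition (⊥) on a pair `(S, S')`. -/
def CondPerp (S S' : Set ℕ) : Prop :=
  ∃ p : ℕ, ∀ c : ℕ, (fun m => c + m) '' (S ∩ Set.Iic p) ≠ S' ∩ Set.Icc c (c + p)

/-- Condition (⊥⁻¹) on a pair `(S, S')` (stated in `ℤ` to handle subtraction). -/
def CondPerpInv (S S' : Set ℕ) : Prop :=
  ∃ p : ℕ, ∀ c : ℕ,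
    (fun m : ℕ => (c : ℤ) - (m : ℤ)) '' (S ∩ Set.Iic p) ≠
      ((fun n : ℕ => (n : ℤ)) '' S') ∩ Set.Icc ((c : ℤ) - (p : ℤ)) (c : ℤ)

/-- `A⁻¹ := {(y,x) : (x,y) ∈ A}`. -/
def invRel {X : Type} (A : Set (X × X)) : Set (X × X) := {p | (p.2, p.1) ∈ A}

/-- `γ_α`: `γ_α(4n+2ε) = ε` and `γ_α(2n+1) = α(n)`. -/
def gammaSeq (α : Cantor) (k : ℕ) : Bool :=
  if k % 2 = 1 then α (k / 2) else decide (k % 4 = 2)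

/-- `β_α(i) := γ_α((i)₀)` where `(i)₀ = max {m : 2^m ∣ i+1}`, with values in `{0,1} ⊆ ω`. -/
def betaSeq (α : Cantor) (i : ℕ) : ℕ :=
  if gammaSeq α ((i + 1).factorization 2) then 1 else 0

/-- `S_β := {Σ_{i<l} (1 + β(i)) : l ∈ ω}`. -/
def Sbeta (β : ℕ → ℕ) : Set ℕ :=
  {m | ∃ l : ℕ, m = ∑ i ∈ Finset.range l, (1 + β i)}

/-- `s_n` as a function `ℕ → Bool` (with junk value `false` beyond `n`). -/
def sSeqFn (n : ℕ) (i : ℕ) : Bool := (sSeq n).getD i false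

/-- The domain of `f¹_n` (direction `d = true`) or of `(f¹_n)⁻¹` (direction `d = false`):
`x` extends `s_n` and `x(n) = !d`. -/
def step1Dom (n : ℕ) (d : Bool) : Set Cantor :=
  {x | (∀ i, i < n → x i = sSeqFn n i) ∧ x n = !d}

/-- `f¹_n` (if `d = true`) or its inverse (if `d = false`): set the `n`-th coordinate to `d`. -/
def step1Fun (n : ℕ) (d : Bool) : Cantor → Cantor := fun x => Function.update x n d

/-- Domain of `fₙ` (direction `d = true`) or of `fₙ⁻¹` (direction `d = false`). -/
def stepDom {X : Type} (D : ℕ → Set X) (f : ℕ → X → X) (n : ℕ) (d : Bool) : Set X :=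
  if d then D n else f n '' D n

/-- `fₙ` (direction `d = true`) or its inverse `gₙ` (direction `d = false`). -/
def stepFun {X : Type} (f g : ℕ → X → X) (n : ℕ) (d : Bool) : X → X :=
  if d then f n else g n

/-- An acyclic situation (Definition 26), with `g n` the inverse of `f n`. -/
def AcyclicSit (X : Type) (t : TopologicalSpace X) (D : ℕ → Set X) (f g : ℕ → X → X) : Prop :=
  Nonempty X ∧ @PolishSpace X t ∧
  @TopologicalSpace.IsTopologicalBasis X t {s : Set X | @IsClopen X t s} ∧
  @Perfect X t Set.univ ∧
  (∀ n, IsPartialHomeo t (D n) (f n)) ∧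
  (∀ n, ∀ x ∈ D n, g n (f n x) = x) ∧
  Set.diagonal X ⊆
    @closure (X × X) (@instTopologicalSpaceProd X X t t) (unionGraphs D f) \ unionGraphs D f ∧
  (∀ m : ℕ, 1 ≤ m → ∀ (v : ℕ → ℕ) (ε : ℕ → Bool),
    (∀ i, i + 1 < m → v i ≠ v (i + 1) ∨ ε i = ε (i + 1)) →
    ∀ U : Set X, @IsClopen X t U → U.Nonempty →
      ∃ V : Set X, @IsClopen X t V ∧ V.Nonempty ∧ V ⊆ U ∧
        ∀ x ∈ V, ∀ w : ℕ → X, w 0 = x →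
          (∀ i, i < m → w i ∈ stepDom D f (v i) (ε i) ∧
            w (i + 1) = stepFun f g (v i) (ε i) (w i)) →
          w m ∉ V)

/-- The relation `ℜ_Θ` on `2^{<ω}`: `e ℜ_Θ e'` iff `e = e'` or
`(e, e') = (θ_n0w, θ_n1w)` for some `n` and `w`. -/
def RTheta (θ : ℕ → List Bool) (e e' : List Bool) : Prop :=
  e = e' ∨ ∃ (n : ℕ) (w : List Bool), e = θ n ++ false :: w ∧ e' = θ n ++ true :: w

/-- The symmetrization `s(ℜ_Θ)`. -/
def sRTheta (θ : ℕ → List Bool) (e e' : List Bool) : Prop :=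
  RTheta θ e e' ∨ RTheta θ e' e

/-- `S` looks from `c` on like `S` from `0` on, up to `p`. -/
def LooksAlike (S : Set ℕ) (p c : ℕ) : Prop := ∀ j ≤ p, j ∈ S ↔ c + j ∈ S

theorem looksAlike_iff {S : Set ℕ} {p c : ℕ} :
    LooksAlike S p c ↔ (fun m => c + m) '' (S ∩ Set.Iic p) = S ∩ Set.Icc c (c + p) := by
  constructor
  · intro h
    ext x
    simp only [mem_image, mem_inter_iff, mem_Iic, mem_Icc]
    constructor
    · rintro ⟨j, ⟨hj, hp⟩, rfl⟩
      exact ⟨(h j hp).1 hj, by omega, by omega⟩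
    · rintro ⟨hx, h1, h2⟩
      obtain ⟨j, rfl⟩ := Nat.exists_eq_add_of_le h1
      exact ⟨j, ⟨(h j (by omega)).2 hx, by omega⟩, rfl⟩
  · intro h j hj
    constructor
    · intro hS
      have : c + j ∈ (fun m => c + m) '' (S ∩ Set.Iic p) := ⟨j, ⟨hS, hj⟩, rfl⟩
      rw [h] at this
      exact this.1
    · intro hS
      have : c + j ∈ S ∩ Set.Icc c (c + p) := ⟨hS, by omega, by omega⟩
      rw [← h] at this
      obtain ⟨i, hi, hij⟩ := this
      obtain rfl : i = j := by simpa using hij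
      exact hi.1

theorem LooksAlike.mem {S : Set ℕ} {p c : ℕ} (h : LooksAlike S p c) (h0 : 0 ∈ S) : c ∈ S :=
  (h 0 (Nat.zero_le _)).1 h0

/-- Set to one all the coordinates of `x` in the finite set `F`. -/
def flipOn (x : Cantor) (F : Finset ℕ) : Cantor := fun j => x j || decide (j ∈ F)

@[simp]
theorem flipOn_empty (x : Cantor) : flipOn x ∅ = x := by
  ext j; simp [flipOn]

theorem flipOn_insert (x : Cantor) (n : ℕ) (F : Finset ℕ) :
    flipOn x (insert n F) = fSfun n (flipOn x F) := by
  ext j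
  by_cases h : j = n
  · subst h; simp [flipOn, fSfun]
  · simp [flipOn, fSfun, h]

theorem flipOn_fSfun (x : Cantor) (n : ℕ) (F : Finset ℕ) :
    flipOn (fSfun n x) F = fSfun n (flipOn x F) := by
  ext j
  by_cases h : j = n
  · subst h; simp [flipOn, fSfun]
  · simp [flipOn, fSfun, h]

theorem cardOnes_eq (x : Cantor) (n : ℕ) :
    cardOnes x n = ((Finset.range n).filter (fun i => x i = true)).card := by
  simp [cardOnes, Finset.sum_boole]

theorem cardOnes_le (x : Cantor) (n : ℕ) : cardOnes x n ≤ n := by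
  rw [cardOnes_eq]
  exact (Finset.card_filter_le _ _).trans (by simp)

theorem cardOnes_congr {x y : Cantor} {n : ℕ} (h : ∀ i < n, x i = y i) :
    cardOnes x n = cardOnes y n :=
  Finset.sum_congr rfl fun i hi => by rw [h i (Finset.mem_range.1 hi)]

theorem cardOnes_flipOn {x : Cantor} {n : ℕ} {F : Finset ℕ} (hF : ∀ i ∈ F, i < n)
    (hx : ∀ i ∈ F, x i = false) : cardOnes (flipOn x F) n = cardOnes x n + F.card := by
  rw [cardOnes_eq, cardOnes_eq, ← Finset.card_union_of_disjoint]
  · congr 1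
    ext i
    simp only [flipOn, Finset.mem_filter, Finset.mem_range, Finset.mem_union, Bool.or_eq_true,
      decide_eq_true_eq]
    constructor
    · tauto
    · rintro (h | h)
      · tauto
      · exact ⟨hF i h, Or.inr h⟩
  · rw [Finset.disjoint_left]
    intro i hi hi'
    simp [hx i hi'] at hi

theorem continuous_fSfun (n : ℕ) : Continuous (fSfun n) :=
  continuous_id.update n continuous_const

theorem continuous_flipOn (F : Finset ℕ) : Continuous fun x => flipOn x F := by
  refine continuous_pi fun j => ?_
  exact (continuous_of_discreteTopology (f := fun b : Bool => b || decide (j ∈ F))).comp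
    (continuous_apply j)

theorem continuous_cardOnes (n : ℕ) : Continuous fun x => cardOnes x n := by
  refine continuous_finsetSum _ fun i _ => ?_
  exact (continuous_of_discreteTopology (f := fun b : Bool => if b then 1 else 0)).comp
    (continuous_apply i)

theorem isClosed_DSdom (S : Set ℕ) (n : ℕ) : IsClosed (DSdom S n) :=
  (isClosed_eq (continuous_apply n) continuous_const).inter
    ((isClosed_discrete S).preimage (continuous_cardOnes n))

theorem mem_ASet {S : Set ℕ} {x y : Cantor} :
    (x, y) ∈ ASet S ↔ ∃ n, x n = false ∧ cardOnes x n ∈ S ∧ y = fSfun n x := by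
  simp [ASet, unionGraphs, graphRel, DSdom, and_assoc]

section Edges

variable {𝓕 : Set (Set Cantor)}

/-- In a family of sets having edges between large subsets, arbitrarily many coordinates can be
flipped simultaneously. -/
theorem exists_flips
    (hF : ∀ E ∈ 𝓕, ∀ l, ∃ n ≥ l, ∃ E' ∈ 𝓕, E' ⊆ E ∧ ∀ x ∈ E', x n = false ∧ fSfun n x ∈ E)
    (K : ℕ) : ∀ E ∈ 𝓕, ∀ l, ∃ V ∈ 𝓕, V ⊆ E ∧ ∃ M ≥ l, ∃ F : ℕ → Finset ℕ, ∀ j ≤ K,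
      (F j).card = j ∧ (∀ i ∈ F j, l ≤ i ∧ i < M) ∧
        ∀ x ∈ V, (∀ i ∈ F j, x i = false) ∧ flipOn x (F j) ∈ E := by
  induction K with
  | zero =>
    intro E hE l
    refine ⟨E, hE, subset_rfl, l, le_rfl, fun _ => ∅, ?_⟩
    intro j hj
    obtain rfl : j = 0 := by omega
    simp
  | succ K ih =>
    intro E hE l
    obtain ⟨n, hn, V₀, hV₀, hV₀E, hx₀⟩ := hF E hE l
    obtain ⟨V, hV, hVV₀, M, hM, F, hFj⟩ := ih V₀ hV₀ (n + 1)
    refine ⟨V, hV, hVV₀.trans hV₀E, M, by omega,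
      fun j => if j ≤ K then F j else insert n (F K), ?_⟩
    intro j hj
    by_cases hjK : j ≤ K
    · simp only [hjK, if_true]
      obtain ⟨h1, h2, h3⟩ := hFj j hjK
      exact ⟨h1, fun i hi => ⟨by have := h2 i hi; omega, (h2 i hi).2⟩,
        fun x hx => ⟨(h3 x hx).1, hV₀E (h3 x hx).2⟩⟩
    · obtain rfl : j = K + 1 := by omega
      simp only [hjK, if_false]
      obtain ⟨h1, h2, h3⟩ := hFj K le_rfl
      have hnF : n ∉ F K := fun h => by have := h2 n h; omega
      refine ⟨by rw [Finset.card_insert_of_notMem hnF, h1], ?_, fun x hx => ⟨?_, ?_⟩⟩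
      · intro i hi
        rcases Finset.mem_insert.1 hi with rfl | hi
        · omega
        · have := h2 i hi
          omega
      · intro i hi
        rcases Finset.mem_insert.1 hi with rfl | hi
        · exact (hx₀ x (hVV₀ hx)).1
        · exact (h3 x hx).1 i hi
      · rw [flipOn_insert]
        exact (hx₀ _ (h3 x hx).2).2

theorem exists_looksAlike_edge {S : Set ℕ} (hM : CondM S) (hne : ∀ E ∈ 𝓕, E.Nonempty)
    (hF : ∀ E ∈ 𝓕, ∀ l, ∃ n ≥ l, ∃ E' ∈ 𝓕, E' ⊆ E ∧ ∀ x ∈ E', x n = false ∧ fSfun n x ∈ E)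
    {E : Set Cantor} (hE : E ∈ 𝓕) (l p : ℕ) :
    ∃ n ≥ l, ∃ x ∈ E, x n = false ∧ fSfun n x ∈ E ∧ LooksAlike S p (cardOnes x n) := by
  obtain ⟨k, hk⟩ := hM p
  obtain ⟨V, hV, hVE, M, hMl, F, hFj⟩ := exists_flips hF k E hE l
  obtain ⟨m, hm, E', hE', hE'V, hx⟩ := hF V hV M
  obtain ⟨x, hxE'⟩ := hne E' hE'
  obtain ⟨hxm, hfx⟩ := hx x hxE'
  obtain ⟨c, hc1, hc2, hc⟩ := hk (cardOnes x m)
  obtain ⟨j, rfl⟩ := Nat.exists_eq_add_of_le hc1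
  obtain ⟨h1, h2, h3⟩ := hFj j (by omega)
  refine ⟨m, hm.trans' hMl, flipOn x (F j), (h3 x (hE'V hxE')).2, ?_, ?_, ?_⟩
  · have : m ∉ F j := fun h => by have := h2 m h; omega
    simp [flipOn, hxm, this]
  · rw [← flipOn_fSfun]
    exact (h3 _ hfx).2
  · rw [cardOnes_flipOn (fun i hi => (h2 i hi).2.trans_le hm) (h3 x (hE'V hxE')).1, h1]
    exact looksAlike_iff.2 hc

end Edges

theorem CondM.condH {S : Set ℕ} (h0 : 0 ∈ S) (hM : CondM S) : CondH S := by
  intro C _ σ hσ hC l p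
  obtain ⟨hne, -, -, -, hhomeo, hdiag⟩ := hC
  have hval : Continuous (Subtype.val : C → Cantor) := continuous_iff_le_induced.2 hσ
  have key := exists_looksAlike_edge (𝓕 := {E | ∃ U : Set C, IsOpen U ∧ U.Nonempty ∧
    Subtype.val '' U = E}) hM ?_ ?_ ⟨univ, isOpen_univ, univ_nonempty, rfl⟩ l p
  · obtain ⟨n, hn, _, ⟨x, -, rfl⟩, hxn, ⟨y, -, hy⟩, hc⟩ := key
    refine ⟨n, hn, x, ⟨⟨hxn, hc.mem h0⟩, ?_⟩, looksAlike_iff.1 hc⟩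
    rw [← hy]
    exact y.2
  · rintro _ ⟨U, -, hU, rfl⟩
    exact hU.image _
  · rintro _ ⟨U, hUo, ⟨x, hx⟩, rfl⟩ l
    have hcl : (x, x) ∈ closure (unionGraphs (fun n => subD C (DSdom S n) (fSfun n))
        (fun n => subF C (fSfun n))) := by
      have : (x, x) ∈ Set.diagonal C := rfl
      rw [hdiag] at this
      exact this.1
    let W : Set C := U ∩ ⋂ i ∈ Finset.range l, {y : C | (y : Cantor) i = (x : Cantor) i}
    have hWo : IsOpen W := by
      refine hUo.inter (isOpen_biInter_finset fun i _ => ?_)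
      exact (isOpen_discrete {(x : Cantor) i}).preimage ((continuous_apply i).comp hval)
    have hxW : x ∈ W := ⟨hx, by simp⟩
    obtain ⟨⟨a, b⟩, ⟨haW, hbW⟩, hab⟩ :=
      mem_closure_iff.1 hcl (W ×ˢ W) (hWo.prod hWo) ⟨hxW, hxW⟩
    obtain ⟨n, haD, hb⟩ := mem_iUnion.1 hab
    dsimp only at haW hbW haD hb
    have hval_b : ∀ z ∈ subD C (DSdom S n) (fSfun n),
        (subF C (fSfun n) z : Cantor) = fSfun n z := by
      intro z hz
      simp [subF, hz.2]
    have hn : l ≤ n := by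
      by_contra! hlt
      have h1 : (a : Cantor) n = (x : Cantor) n := by
        simpa using mem_iInter₂.1 haW.2 n (Finset.mem_range.2 hlt)
      have h2 : (b : Cantor) n = (x : Cantor) n := by
        simpa using mem_iInter₂.1 hbW.2 n (Finset.mem_range.2 hlt)
      rw [hb, hval_b a haD, ← h1, haD.1.1] at h2
      simp [fSfun] at h2
    obtain ⟨hDc, -, hfc, -⟩ := hhomeo n
    refine ⟨n, hn, _, ⟨U ∩ (subD C (DSdom S n) (fSfun n) ∩ subF C (fSfun n) ⁻¹' U), ?_,
      ⟨a, haW.1, haD, ?_⟩, rfl⟩, image_mono inter_subset_left, ?_⟩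
    · exact hUo.inter (hfc.isOpen_inter_preimage hDc.isOpen hUo)
    · rw [mem_preimage, ← hb]
      exact hbW.1
    · rintro _ ⟨z, ⟨-, hzD, hzU⟩, rfl⟩
      exact ⟨hzD.1.1, _, hzU, hval_b z hzD⟩

/-- `B` contains no edge of `A^S`. -/
def ASetIndep (S : Set ℕ) (B : Set Cantor) : Prop := ∀ x ∈ B, ∀ y ∈ B, (x, y) ∉ ASet S

/-- `E` can be covered by countably many Borel `A^S`-independent sets. -/
def CtblColorable (S : Set ℕ) (E : Set Cantor) : Prop :=
  ∃ B : ℕ → Set Cantor, (∀ i, MeasurableSet (B i)) ∧ (∀ i, ASetIndep S (B i)) ∧ E ⊆ ⋃ i, B i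

instance polishSpace_bool : PolishSpace Bool :=
  (IsClosedEmbedding.of_continuous_injective_isClosedMap (f := Bool.toNat)
    continuous_of_discreteTopology (by decide) fun _ _ => isClosed_discrete _).polishSpace

theorem MeasureTheory.AnalyticSet.inter {α : Type*} [TopologicalSpace α] [T2Space α]
    {E F : Set α} (hE : AnalyticSet E) (hF : AnalyticSet F) : AnalyticSet (E ∩ F) := by
  rw [inter_eq_iInter]
  exact AnalyticSet.iInter fun b => by cases b <;> assumption

section Colorable

open MeasureTheory

variable {S : Set ℕ}

theorem CtblColorable.mono {E E' : Set Cantor} (h : CtblColorable S E) (hE : E' ⊆ E) :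
    CtblColorable S E' := by
  obtain ⟨B, h1, h2, h3⟩ := h
  exact ⟨B, h1, h2, hE.trans h3⟩

theorem CtblColorable.iUnion {ι : Type*} [Countable ι] {E : ι → Set Cantor}
    (h : ∀ i, CtblColorable S (E i)) : CtblColorable S (⋃ i, E i) := by
  choose B h1 h2 h3 using h
  rcases isEmpty_or_nonempty ι with hι | hι
  · exact ⟨fun _ => ∅, fun _ => MeasurableSet.empty, fun _ => by simp [ASetIndep], by simp⟩
  obtain ⟨e, he⟩ := exists_surjective_nat (ι × ℕ)
  refine ⟨fun n => B (e n).1 (e n).2, fun n => h1 _ _, fun n => h2 _ _, ?_⟩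
  refine iUnion_subset fun i => (h3 i).trans (iUnion_subset fun j => ?_)
  obtain ⟨n, hn⟩ := he (i, j)
  intro x hx
  exact mem_iUnion.2 ⟨n, by rw [hn]; exact hx⟩

theorem CtblColorable.union {E E' : Set Cantor} (h : CtblColorable S E)
    (h' : CtblColorable S E') : CtblColorable S (E ∪ E') := by
  rw [union_eq_iUnion]
  exact CtblColorable.iUnion fun b => by cases b <;> assumption

theorem CtblColorable.nonempty_of_not {E : Set Cantor} (h : ¬ CtblColorable S E) :
    E.Nonempty := by
  by_contra hE
  rw [not_nonempty_iff_eq_empty] at hE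
  exact h ⟨fun _ => ∅, fun _ => MeasurableSet.empty, fun _ => by simp [ASetIndep], by simp [hE]⟩

/-- An analytic independent set is contained in a Borel independent set. -/
theorem ASetIndep.ctblColorable {E : Set Cantor} (hE : AnalyticSet E) (h : ASetIndep S E) :
    CtblColorable S E := by
  have hT : AnalyticSet (⋃ n, fSfun n '' (E ∩ DSdom S n)) :=
    AnalyticSet.iUnion fun n => (hE.inter (isClosed_DSdom S n).analyticSet).image_of_continuous
      (continuous_fSfun n)
  obtain ⟨B, hEB, hTB, hB⟩ := hE.measurablySeparable hT (by
    rw [Set.disjoint_left]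
    intro y hy hy'
    obtain ⟨n, x, ⟨hx, hxn⟩, rfl⟩ := mem_iUnion.1 hy'
    exact h x hx _ hy (mem_ASet.2 ⟨n, hxn.1, hxn.2, rfl⟩))
  refine ⟨fun _ => B \ ⋃ n, DSdom S n ∩ fSfun n ⁻¹' B, fun _ => ?_, fun _ => ?_, ?_⟩
  · exact hB.diff (MeasurableSet.iUnion fun n => (isClosed_DSdom S n).measurableSet.inter
      ((continuous_fSfun n).measurable hB))
  · intro x hx y hy hxy
    obtain ⟨n, h1, h2, rfl⟩ := mem_ASet.1 hxy
    exact hx.2 (mem_iUnion.2 ⟨n, ⟨h1, h2⟩, hy.1⟩)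
  · rw [iUnion_const]
    intro x hx
    refine ⟨hEB hx, fun hx' => ?_⟩
    obtain ⟨n, hxn, hxB⟩ := mem_iUnion.1 hx'
    exact Set.disjoint_left.1 hTB (mem_iUnion.2 ⟨n, x, ⟨hx, hxn⟩, rfl⟩) hxB

/-- Analytic sets which cannot be coloured remain so after removing countably many
colourable sets; hence they have an uncolourable intersection with a member of any countable family
of sets outside of which they are colourable. -/
theorem exists_not_ctblColorable {ι : Type*} [Countable ι] {E : Set Cantor}
    (hE : AnalyticSet E) (hS : ¬ CtblColorable S E) (P : ι → Set Cantor)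
    (h : ∀ E' ⊆ E, AnalyticSet E' → (∀ i, E' ∩ P i = ∅) → CtblColorable S E') :
    ∃ i, ¬ CtblColorable S (E ∩ P i) := by
  by_contra! hP
  obtain ⟨B, hB1, hB2, hB3⟩ := CtblColorable.iUnion hP
  refine hS ?_
  have h1 : CtblColorable S (E ∩ (⋃ i, B i)ᶜ) := by
    refine h _ inter_subset_left
      (hE.inter (MeasurableSet.iUnion hB1).compl.analyticSet) fun i => ?_
    rw [eq_empty_iff_forall_notMem]
    rintro x ⟨⟨hx, hxB⟩, hxP⟩
    exact hxB (hB3 (mem_iUnion.2 ⟨i, hx, hxP⟩))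
  have h2 : CtblColorable S (⋃ i, B i) := ⟨B, hB1, hB2, subset_rfl⟩
  refine (h1.union h2).mono fun x hx => ?_
  by_cases hxB : x ∈ ⋃ i, B i
  · exact Or.inr hxB
  · exact Or.inl ⟨hx, hxB⟩

theorem exists_edges_not_ctblColorable {E : Set Cantor} (hE : AnalyticSet E)
    (hS : ¬ CtblColorable S E) (l : ℕ) :
    ∃ n ≥ l, ¬ CtblColorable S (E ∩ (DSdom S n ∩ fSfun n ⁻¹' E)) := by
  suffices h : ∃ n : {n // l ≤ n}, ¬ CtblColorable S (E ∩ (DSdom S n ∩ fSfun n ⁻¹' E)) by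
    obtain ⟨⟨n, hn⟩, h⟩ := h
    exact ⟨n, hn, h⟩
  refine exists_not_ctblColorable hE hS _ ?_
  intro E' hE'E hE' hdis
  have hcov : E' = ⋃ s : Fin l → Bool, E' ∩ {x | ∀ i : Fin l, x i = s i} := by
    ext x
    simp only [mem_iUnion, mem_inter_iff, mem_ofPred_eq]
    exact ⟨fun hx => ⟨fun i => x i, hx, fun _ => rfl⟩, fun ⟨_, hx, _⟩ => hx⟩
  rw [hcov]
  refine CtblColorable.iUnion fun s => ASetIndep.ctblColorable ?_ ?_
  · refine hE'.inter (IsClosed.analyticSet ?_)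
    rw [ofPred_forall]
    exact isClosed_iInter fun i => isClosed_eq (continuous_apply _) continuous_const
  · rintro x ⟨hx, hxs⟩ y ⟨hy, hys⟩ hxy
    obtain ⟨n, h1, h2, rfl⟩ := mem_ASet.1 hxy
    by_cases hn : l ≤ n
    · have : x ∈ E' ∩ (DSdom S n ∩ fSfun n ⁻¹' E) := ⟨hx, ⟨h1, h2⟩, hE'E hy⟩
      rw [hdis ⟨n, hn⟩] at this
      exact this
    · have h3 := hxs ⟨n, by omega⟩
      have h4 := hys ⟨n, by omega⟩
      rw [← h3] at h4
      simp [fSfun, h1] at h4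

theorem exists_looksAlike_not_ctblColorable (hM : CondM S) {E : Set Cantor}
    (hE : AnalyticSet E) (hS : ¬ CtblColorable S E) (l p : ℕ) :
    ∃ n ≥ l, ∃ c, LooksAlike S p c ∧
      ¬ CtblColorable S (E ∩ {x | x n = false ∧ cardOnes x n = c ∧ fSfun n x ∈ E}) := by
  suffices h : ∃ i : {n // l ≤ n} × {c // LooksAlike S p c}, ¬ CtblColorable S
      (E ∩ {x | x i.1 = false ∧ cardOnes x i.1 = i.2 ∧ fSfun i.1 x ∈ E}) by
    obtain ⟨⟨⟨n, hn⟩, c, hc⟩, h⟩ := h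
    exact ⟨n, hn, c, hc, h⟩
  refine exists_not_ctblColorable hE hS _ ?_
  intro E' hE'E hE' hdis
  by_contra hS'
  obtain ⟨n, hn, x, hx, hxn, hfx, hc⟩ := exists_looksAlike_edge
    (𝓕 := {E | AnalyticSet E ∧ ¬ CtblColorable S E}) hM
    (fun E hE => CtblColorable.nonempty_of_not hE.2) (fun E hE l => by
      obtain ⟨n, hn, h⟩ := exists_edges_not_ctblColorable hE.1 hE.2 l
      refine ⟨n, hn, _, ⟨?_, h⟩, inter_subset_left, fun x hx => ⟨hx.2.1.1, hx.2.2⟩⟩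
      exact hE.1.inter ((isClosed_DSdom S n).analyticSet.inter
        (hE.1.preimage (continuous_fSfun n)))) ⟨hE', hS'⟩ l p
  have : x ∈ (∅ : Set Cantor) := by
    rw [← hdis ⟨⟨n, hn⟩, _, hc⟩]
    exact ⟨hx, hxn, rfl, hE'E hfx⟩
  exact this

/-- If the preimage of `A^S` is closed, then the common values of the two maps can be coloured. -/
theorem ctblColorable_of_isClosed {X Y : Type*} [TopologicalSpace X] [PolishSpace X]
    [TopologicalSpace Y] [PolishSpace Y] {u : X → Cantor} {v : Y → Cantor} (hu : Continuous u)
    (hv : Continuous v) (h : IsClosed ((fun p : X × Y => (u p.1, v p.2)) ⁻¹' ASet S)) :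
    CtblColorable S (range u ∩ range v) := by
  let 𝓑 := {q : TopologicalSpace.countableBasis X × TopologicalSpace.countableBasis Y |
    ∀ x ∈ q.1.1, ∀ y ∈ q.2.1, (u x, v y) ∉ ASet S}
  have key : CtblColorable S (⋃ q : 𝓑, u '' q.1.1.1 ∩ v '' q.1.2.1) := by
    refine CtblColorable.iUnion fun q => ASetIndep.ctblColorable ?_ ?_
    · exact AnalyticSet.inter
        ((TopologicalSpace.isOpen_of_mem_countableBasis q.1.1.2).analyticSet_image hu)
        ((TopologicalSpace.isOpen_of_mem_countableBasis q.1.2.2).analyticSet_image hv)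
    · rintro _ ⟨⟨x, hx, rfl⟩, -⟩ _ ⟨-, ⟨y, hy, rfl⟩⟩
      exact q.2 x hx y hy
  refine key.mono ?_
  rintro _ ⟨⟨x, rfl⟩, ⟨y, hy⟩⟩
  have hxy : (x, y) ∈ ((fun p : X × Y => (u p.1, v p.2)) ⁻¹' ASet S)ᶜ := by
    intro hmem
    rw [mem_preimage, hy] at hmem
    obtain ⟨n, h1, -, h2⟩ := mem_ASet.1 hmem
    simpa [fSfun, h1] using congrFun h2 n
  obtain ⟨U, V, hU, hV, hxU, hyV, hUV⟩ := isOpen_prod_iff.1 h.isOpen_compl x y hxy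
  obtain ⟨U', hU', hxU', hUU'⟩ :=
    (TopologicalSpace.isBasis_countableBasis X).exists_subset_of_mem_open hxU hU
  obtain ⟨V', hV', hyV', hVV'⟩ :=
    (TopologicalSpace.isBasis_countableBasis Y).exists_subset_of_mem_open hyV hV
  refine mem_iUnion.2 ⟨⟨⟨⟨U', hU'⟩, ⟨V', hV'⟩⟩, fun a ha b hb => ?_⟩, ⟨x, hxU', rfl⟩,
    ⟨y, hyV', hy⟩⟩
  exact hUV (mk_mem_prod (hUU' ha) (hVV' hb))

theorem isOpen_compl_ASet_union_diagonal : IsOpen (ASet S ∪ diagonal Cantor)ᶜ := by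
  have : (ASet S ∪ diagonal Cantor)ᶜ = ⋃ j, ({p : Cantor × Cantor | p.1 j = p.2 j} ∪
      (Prod.fst ⁻¹' DSdom S j ∩ {p : Cantor × Cantor | p.2 = fSfun j p.1}))ᶜ := by
    ext ⟨x, y⟩
    simp only [mem_compl_iff, mem_union, mem_diagonal_iff, mem_iUnion, mem_ofPred_eq, mem_inter_iff,
      mem_preimage, not_or]
    constructor
    · rintro ⟨h, hxy⟩
      obtain ⟨j, hj⟩ := Function.ne_iff.1 hxy
      exact ⟨j, hj, fun h' => h (mem_ASet.2 ⟨j, h'.1.1, h'.1.2, h'.2⟩)⟩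
    · rintro ⟨j, hj, hxy⟩
      refine ⟨fun h => ?_, fun h => hj (by rw [h])⟩
      obtain ⟨n, h1, h2, rfl⟩ := mem_ASet.1 h
      by_cases hjn : j = n
      · subst hjn
        exact hxy ⟨⟨h1, h2⟩, rfl⟩
      · simp [fSfun, hjn] at hj
  rw [this]
  refine isOpen_iUnion fun j => (IsClosed.union ?_ (IsClosed.inter ?_ ?_)).isOpen_compl
  · exact isClosed_eq ((continuous_apply j).comp continuous_fst)
      ((continuous_apply j).comp continuous_snd)
  · exact (isClosed_DSdom S j).preimage continuous_fst
  · exact isClosed_eq continuous_snd ((continuous_fSfun j).comp continuous_fst)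

theorem potClosed_of_ctblColorable {X Y : Type} [tX : TopologicalSpace X] [PolishSpace X]
    [tY : TopologicalSpace Y] [PolishSpace Y] {u : X → Cantor} {v : Y → Cantor}
    (hu : Continuous u) (hv : Continuous v) (h : CtblColorable S (range u ∩ range v)) :
    PotClosed tX tY ((fun p : X × Y => (u p.1, v p.2)) ⁻¹' ASet S) := by
  classical
  obtain ⟨B, hB1, hB2, hB3⟩ := h
  let c : Cantor → ℕ → Bool := fun z i => decide (z ∈ B i)
  have hc : Measurable c := measurable_pi_lambda _ fun i =>
    measurable_to_bool (by simpa [c, preimage] using hB1 i)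
  borelize X Y
  obtain ⟨σ, hσ, hσc, hσP⟩ := (hc.comp hu.measurable).exists_continuous
  obtain ⟨τ, hτ, hτc, hτP⟩ := (hc.comp hv.measurable).exists_continuous
  refine ⟨σ, τ, hσ, hτ, hσP, hτP, ?_⟩
  have hu' : Continuous[σ, _] u := continuous_le_dom hσ hu
  have hv' : Continuous[τ, _] v := continuous_le_dom hτ hv
  clear hσ hτ hσP hτP hu hv
  let := σ
  let := τ
  have hcompl : ((fun p : X × Y => (u p.1, v p.2)) ⁻¹' ASet S)ᶜ =
      (fun p : X × Y => (u p.1, v p.2)) ⁻¹' (ASet S ∪ diagonal Cantor)ᶜ ∪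
        ⋃ i, {x | c (u x) i = true} ×ˢ {y | c (v y) i = true} := by
    ext ⟨x, y⟩
    simp only [mem_compl_iff, mem_preimage, mem_union, mem_iUnion, mem_prod, mem_ofPred_eq, c,
      decide_eq_true_eq, mem_diagonal_iff, not_or]
    constructor
    · intro hxy
      by_cases heq : u x = v y
      · obtain ⟨i, hi⟩ := mem_iUnion.1 (hB3 ⟨⟨x, rfl⟩, ⟨y, heq.symm⟩⟩)
        exact Or.inr ⟨i, hi, heq ▸ hi⟩
      · exact Or.inl ⟨hxy, heq⟩
    · rintro (h | ⟨i, hx, hy⟩)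
      · exact h.1
      · exact hB2 i _ hx _ hy
  rw [← isOpen_compl_iff, hcompl]
  refine IsOpen.union ?_ (isOpen_iUnion fun i => IsOpen.prod ?_ ?_)
  · exact isOpen_compl_ASet_union_diagonal.preimage
      ((hu'.comp continuous_fst).prodMk (hv'.comp continuous_snd))
  · exact (isOpen_discrete {true}).preimage ((continuous_apply i).comp hσc)
  · exact (isOpen_discrete {true}).preimage ((continuous_apply i).comp hτc)

/-- The homeomorphism of the Cantor space flipping the `n`-th coordinate. -/
def toggle (n : ℕ) : Cantor ≃ₜ Cantor where
  toFun x := Function.update x n (!x n)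
  invFun x := Function.update x n (!x n)
  left_inv x := by simp
  right_inv x := by simp
  continuous_toFun := continuous_id.update n
    ((continuous_of_discreteTopology (f := not)).comp (continuous_apply n))
  continuous_invFun := continuous_id.update n
    ((continuous_of_discreteTopology (f := not)).comp (continuous_apply n))

theorem not_ctblColorable_univ (hinf : S.Infinite) : ¬ CtblColorable S univ := by
  rintro ⟨B, hB1, hB2, hB3⟩
  have hmeagre : ∃ i, ¬ IsMeagre (B i) := by
    by_contra! h
    exact not_isMeagre_of_isOpen isOpen_univ (univ_nonempty (α := Cantor))
      ((isMeagre_iUnion h).mono hB3)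
  obtain ⟨i, hi⟩ := hmeagre
  obtain ⟨U, hU, hBU⟩ := (hB1 i).residualEq_isOpen
  have hBU' : ∀ᶠ x in residual Cantor, x ∈ B i ↔ x ∈ U := Filter.eventuallyEq_set.1 hBU
  have hUne : U.Nonempty := by
    by_contra hU0
    rw [not_nonempty_iff_eq_empty] at hU0
    refine hi ?_
    filter_upwards [hBU'] with x hx
    simpa [hU0] using hx
  obtain ⟨x, hx⟩ := hUne
  obtain ⟨N, hN⟩ : ∃ N, ∀ y : Cantor, (∀ j < N, y j = x j) → y ∈ U := by
    obtain ⟨I, W, hW, hIW⟩ := isOpen_pi_iff.1 hU x hx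
    refine ⟨I.sup id + 1, fun y hy => hIW fun j hj => ?_⟩
    rw [hy j (Nat.lt_succ_of_le (Finset.le_sup (f := id) hj))]
    exact (hW j hj).2
  obtain ⟨s, hs, hsN⟩ := hinf.exists_gt N
  let n := N + (s - cardOnes x N)
  have hnN : N ≤ n := Nat.le_add_right _ _
  let z : Cantor := fun j => if j < N then x j else decide (j < n)
  have hzcard : cardOnes z n = s := by
    have h1 := cardOnes_le x N
    have h2 : cardOnes z N = cardOnes x N :=
      cardOnes_congr fun j hj => by simp [z, hj]
    have h3 : cardOnes z n = cardOnes z N + (s - cardOnes x N) := by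
      have h4 : ∀ j ∈ Finset.range (s - cardOnes x N), (if z (N + j) then 1 else 0) = 1 := by
        intro j hj
        have : N + j < n := by have := Finset.mem_range.1 hj; omega
        simp [z, this]
      rw [show cardOnes z n = _ from Finset.sum_range_add _ N _, Finset.sum_congr rfl h4,
        Finset.sum_const, Finset.card_range, smul_eq_mul, mul_one]
      rfl
    omega
  let W : Set Cantor := {y | ∀ j ∈ Finset.range (n + 1), y j = z j}
  have hW : IsOpen W := by
    have : W = ⋂ j ∈ Finset.range (n + 1), (fun y : Cantor => y j) ⁻¹' {z j} := by
      ext y; simp [W]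
    rw [this]
    exact isOpen_biInter_finset fun j _ => (isOpen_discrete _).preimage (continuous_apply j)
  have h2 : ∀ᶠ y in residual Cantor, toggle n y ∈ B i ↔ toggle n y ∈ U := by
    have : Filter.Tendsto (toggle n) (residual Cantor) (residual Cantor) :=
      (toggle n).residual_map_eq.le
    exact this.eventually hBU'
  obtain ⟨y, hyW, hy1, hy2⟩ := (dense_of_mem_residual (hBU'.and h2)).inter_open_nonempty W hW
    ⟨z, fun _ _ => rfl⟩
  have hyz : ∀ j ≤ n, y j = z j := fun j hj => hyW j (Finset.mem_range.2 (by omega))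
  have hyn : y n = false := by
    rw [hyz n le_rfl]
    simp [z, hnN]
  have hyB : y ∈ B i := hy1.2 (hN y fun j hj => by rw [hyz j (by omega)]; simp [z, hj])
  have hyB' : toggle n y ∈ B i := hy2.2 (hN _ fun j hj => by
    have : j ≠ n := by omega
    simp only [toggle, Homeomorph.homeomorph_mk_coe, Equiv.coe_fn_mk]
    rw [Function.update_of_ne this, hyz j (by omega)]
    simp [z, hj])
  refine hB2 i y hyB _ hyB' (mem_ASet.2 ⟨n, hyn, ?_, ?_⟩)
  · rw [cardOnes_congr (y := z) fun j hj => hyz j hj.le, hzcard]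
    exact hs
  · simp [toggle, fSfun, hyn]

theorem not_potClosed_ASet (hinf : S.Infinite) :
    ¬ PotClosed inferInstance inferInstance (ASet S) := by
  rintro ⟨σ, τ, hσ, hτ, hσP, hτP, h⟩
  refine not_ctblColorable_univ hinf ?_
  have := @ctblColorable_of_isClosed S Cantor Cantor σ hσP τ hτP id id
    (continuous_id_iff_le.2 hσ) (continuous_id_iff_le.2 hτ) h
  simpa using this

end Colorable

/-- The data of a fusion: the coordinates to be flipped, the numbers of ones before them, and
the values of the points of the Baire space which are constructed. -/
structure FusionData where
  /-- The coordinates which are flipped. -/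
  coord : ℕ → ℕ
  /-- The number of ones before each coordinate. -/
  ones : ℕ → ℕ
  /-- The `i`-th value of the point associated with a finite set of flips. -/
  value : ℕ → Finset ℕ → ℕ

namespace FusionData

open MeasureTheory

variable {S : Set ℕ} {w : (ℕ → ℕ) → Cantor}

/-- The first `k` stages of two fusions coincide. -/
def Agree (k : ℕ) (d d' : FusionData) : Prop :=
  ∀ i < k, d.coord i = d'.coord i ∧ d.ones i = d'.ones i ∧ d.value i = d'.value i

/-- The possible base points after `k` stages of the fusion. -/
def approx (w : (ℕ → ℕ) → Cantor) (d : FusionData) (k : ℕ) : Set Cantor :=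
  {x | (∀ i < k, x (d.coord i) = false ∧ cardOnes x (d.coord i) = d.ones i) ∧
    ∀ F ⊆ Finset.range k, ∃ z : ℕ → ℕ, (∀ i < k, z i = d.value i (F ∩ Finset.range (i + 1))) ∧
      w z = flipOn x (F.image d.coord)}

/-- The first `k` stages of the fusion are correct. -/
def Valid (S : Set ℕ) (w : (ℕ → ℕ) → Cantor) (d : FusionData) (k : ℕ) : Prop :=
  ¬ CtblColorable S (d.approx w k) ∧ (∀ i j, i < j → j < k → d.coord i < d.coord j) ∧
    ∀ i < k, LooksAlike S i (d.ones i)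

theorem Agree.approx_subset {k : ℕ} {d d' : FusionData} (h : Agree k d d') :
    d.approx w k ⊆ d'.approx w k := by
  rintro x ⟨h1, h2⟩
  refine ⟨fun i hi => ?_, fun F hF => ?_⟩
  · rw [← (h i hi).1, ← (h i hi).2.1]
    exact h1 i hi
  · obtain ⟨z, hz, hwz⟩ := h2 F hF
    refine ⟨z, fun i hi => ?_, ?_⟩
    · rw [← (h i hi).2.2]
      exact hz i hi
    · rw [hwz, Finset.image_congr]
      exact fun i hi => (h i (Finset.mem_range.1 (hF hi))).1

theorem Agree.valid {k : ℕ} {d d' : FusionData} (h : Agree k d d') (hd : d.Valid S w k) :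
    d'.Valid S w k := by
  refine ⟨fun h' => hd.1 (h'.mono h.approx_subset), fun i j hij hj => ?_, fun i hi => ?_⟩
  · rw [← (h i (hij.trans hj)).1, ← (h j hj).1]
    exact hd.2.1 i j hij hj
  · rw [← (h i hi).2.1]
    exact hd.2.2 i hi

theorem analyticSet_approx (hw : Continuous w) (d : FusionData) (k : ℕ) :
    AnalyticSet (d.approx w k) := by
  have : d.approx w k = {x | ∀ i < k, x (d.coord i) = false ∧ cardOnes x (d.coord i) = d.ones i} ∩
      ⋂ F : {F : Finset ℕ // F ⊆ Finset.range k}, (fun x => flipOn x (F.1.image d.coord)) ⁻¹'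
        (w '' {z | ∀ i < k, z i = d.value i (F.1 ∩ Finset.range (i + 1))}) := by
    ext x
    simp [approx]
  rw [this]
  refine AnalyticSet.inter (IsClosed.analyticSet ?_) ?_
  · simp only [ofPred_forall]
    exact isClosed_iInter fun i => isClosed_iInter fun _ =>
      (isClosed_eq (continuous_apply _) continuous_const).inter
        (isClosed_eq (continuous_cardOnes _) continuous_const)
  · have : Nonempty {F : Finset ℕ // F ⊆ Finset.range k} := ⟨∅, Finset.empty_subset _⟩
    refine AnalyticSet.iInter fun F => AnalyticSet.preimage ?_ (continuous_flipOn _)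
    refine (IsClosed.analyticSet ?_).image_of_continuous hw
    simp only [ofPred_forall]
    exact isClosed_iInter fun i => isClosed_iInter fun _ =>
      isClosed_eq (continuous_apply _) continuous_const

/-- Extend a fusion by one stage. -/
def extend (d : FusionData) (k m c : ℕ) (b : Finset ℕ → ℕ) : FusionData where
  coord := Function.update d.coord k m
  ones := Function.update d.ones k c
  value := Function.update d.value k b

theorem agree_extend (d : FusionData) (k m c : ℕ) (b : Finset ℕ → ℕ) :
    Agree k d (d.extend k m c b) := by
  intro i hi
  simp [extend, hi.ne]

/-- A partial choice of values, extended to all finite sets. -/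
noncomputable def extendValue {k : ℕ} (b : {F : Finset ℕ // F ⊆ Finset.range (k + 1)} → ℕ)
    (F : Finset ℕ) : ℕ :=
  if h : F ⊆ Finset.range (k + 1) then b ⟨F, h⟩ else 0

theorem exists_mem_approx_extend {d : FusionData} {k m c : ℕ} {x : Cantor}
    (hx : x ∈ d.approx w k) (hxm : x m = false) (hc : cardOnes x m = c)
    (hfx : fSfun m x ∈ d.approx w k) :
    ∃ b : {F : Finset ℕ // F ⊆ Finset.range (k + 1)} → ℕ,
      x ∈ (d.extend k m c (extendValue b)).approx w (k + 1) := by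
  have himage : ∀ F ⊆ Finset.range k, F.image (Function.update d.coord k m) =
      F.image d.coord := fun F hF => Finset.image_congr fun i hi => by
    have := Finset.mem_range.1 (hF hi)
    simp [this.ne]
  have key : ∀ F : {F : Finset ℕ // F ⊆ Finset.range (k + 1)}, ∃ z : ℕ → ℕ,
      (∀ i < k, z i = d.value i (F.1 ∩ Finset.range (i + 1))) ∧
        w z = flipOn x (F.1.image (Function.update d.coord k m)) := by
    rintro ⟨F, hF⟩
    have hF' : F.erase k ⊆ Finset.range k := by
      intro i hi
      rw [Finset.mem_erase] at hi
      have := Finset.mem_range.1 (hF hi.2)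
      rw [Finset.mem_range]
      omega
    by_cases hk : k ∈ F
    · obtain ⟨z, hz, hwz⟩ := hfx.2 _ hF'
      refine ⟨z, fun i hi => ?_, ?_⟩
      · rw [hz i hi]
        congr 1
        ext j
        simp only [Finset.mem_inter, Finset.mem_erase, Finset.mem_range]
        constructor
        · tauto
        · rintro ⟨h1, h2⟩
          exact ⟨⟨by omega, h1⟩, h2⟩
      · dsimp only
        rw [hwz, flipOn_fSfun, ← flipOn_insert, ← himage _ hF']
        conv_rhs => rw [← Finset.insert_erase hk, Finset.image_insert, Function.update_self]
    · rw [Finset.erase_eq_of_notMem hk] at hF'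
      dsimp only
      rw [himage _ hF']
      exact hx.2 F hF'
  choose z hz hwz using key
  refine ⟨fun F => z F k, fun i hi => ?_, fun F hF => ⟨z ⟨F, hF⟩, fun i hi => ?_, hwz ⟨F, hF⟩⟩⟩
  · by_cases hik : i = k
    · subst hik
      simp [extend, hxm, hc]
    · simpa [extend, hik] using hx.1 i (by omega)
  · by_cases hik : i = k
    · subst hik
      simp [extend, extendValue, hF, Finset.inter_eq_left.2 hF]
    · simpa [extend, hik] using hz ⟨F, hF⟩ i (by omega)

theorem Valid.exists_succ (hM : CondM S) (hw : Continuous w) {d : FusionData} {k : ℕ}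
    (hd : d.Valid S w k) : ∃ d', d'.Valid S w (k + 1) ∧ Agree k d d' := by
  obtain ⟨m, hm, c, hc, hS⟩ := exists_looksAlike_not_ctblColorable hM
    (analyticSet_approx hw d k) hd.1 (∑ i ∈ Finset.range k, (d.coord i + 1)) k
  have hb : ∃ b : {F : Finset ℕ // F ⊆ Finset.range (k + 1)} → ℕ,
      ¬ CtblColorable S ((d.extend k m c (extendValue b)).approx w (k + 1)) := by
    have : Finite {F : Finset ℕ // F ⊆ Finset.range (k + 1)} :=
      Finite.of_injective (fun F => (⟨F.1, Finset.mem_powerset.2 F.2⟩ :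
        (Finset.range (k + 1)).powerset)) fun F G h => Subtype.ext (by simpa using h)
    by_contra! h
    refine hS ((CtblColorable.iUnion h).mono ?_)
    rintro x ⟨hx, hxm, hxc, hfx⟩
    exact mem_iUnion.2 (exists_mem_approx_extend hx hxm hxc hfx)
  obtain ⟨b, hb⟩ := hb
  refine ⟨_, ⟨hb, fun i j hij hj => ?_, fun i hi => ?_⟩, agree_extend d k m c _⟩
  · by_cases hjk : j = k
    · subst hjk
      have : d.coord i + 1 ≤ ∑ i ∈ Finset.range j, (d.coord i + 1) :=
        Finset.single_le_sum (f := fun i => d.coord i + 1) (fun _ _ => Nat.zero_le _)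
          (Finset.mem_range.2 hij)
      simp only [extend, Function.update_self, Function.update_of_ne hij.ne]
      omega
    · have hjk' : j < k := by omega
      simpa [extend, hjk, (hij.trans hjk').ne] using hd.2.1 i j hij hjk'
  · by_cases hik : i = k
    · subst hik
      simpa [extend] using hc
    · simpa [extend, hik] using hd.2.2 i (by omega)

theorem exists_forall_valid (hM : CondM S) (hw : Continuous w)
    (hS : ¬ CtblColorable S (range w)) : ∃ d : FusionData, ∀ k, d.Valid S w k := by
  have hstep : ∀ k (d : FusionData), d.Valid S w k →
      ∃ d' : FusionData, d'.Valid S w (k + 1) ∧ Agree k d d' :=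
    fun _ _ hd => hd.exists_succ hM hw
  choose! next hnext hagree using hstep
  let st : ℕ → FusionData := Nat.rec ⟨0, 0, 0⟩ next
  have hst : ∀ k, (st k).Valid S w k := by
    intro k
    induction k with
    | zero =>
      refine ⟨fun h => hS (h.mono ?_), by simp, by simp⟩
      rintro _ ⟨z, rfl⟩
      refine ⟨by simp, fun F hF => ⟨z, by simp, ?_⟩⟩
      have : F = ∅ := by simpa using hF
      simp [this]
    | succ k ih => exact hnext k _ ih
  have hag : ∀ i k, i + 1 ≤ k → (st (i + 1)).coord i = (st k).coord i ∧
      (st (i + 1)).ones i = (st k).ones i ∧ (st (i + 1)).value i = (st k).value i := by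
    intro i k hik
    induction k, hik using Nat.le_induction with
    | base => exact ⟨rfl, rfl, rfl⟩
    | succ k hk ih =>
      obtain ⟨h1, h2, h3⟩ := hagree k _ (hst k) i hk
      exact ⟨ih.1.trans h1, ih.2.1.trans h2, ih.2.2.trans h3⟩
  refine ⟨⟨fun i => (st (i + 1)).coord i, fun i => (st (i + 1)).ones i,
    fun i => (st (i + 1)).value i⟩, fun k => Agree.valid (d := st k) (fun i hi => ?_) (hst k)⟩
  obtain ⟨h1, h2, h3⟩ := hag i k hi
  exact ⟨h1.symm, h2.symm, h3.symm⟩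

/-- The point of the Baire space obtained along `α`. -/
def limit (d : FusionData) (α : Cantor) : ℕ → ℕ :=
  fun i => d.value i ((Finset.range (i + 1)).filter fun j => α j = true)

theorem continuous_limit (d : FusionData) : Continuous d.limit := by
  refine continuous_pi fun i => IsLocallyConstant.continuous ?_
  refine (IsLocallyConstant.iff_exists_open _).2 fun α =>
    ⟨⋂ j ∈ Finset.range (i + 1), (fun β : Cantor => β j) ⁻¹' {α j},
      isOpen_biInter_finset fun j _ => (isOpen_discrete _).preimage (continuous_apply j),
      by simp, fun β hβ => ?_⟩
  unfold limit
  congr 1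
  refine Finset.filter_congr fun j hj => ?_
  have : β j = α j := mem_iInter₂.1 hβ j hj
  rw [this]

theorem eventually_eq_of_agree (hw : Continuous w) (z₀ : ℕ → ℕ) (J : ℕ) :
    ∃ K, ∀ z, (∀ i < K, z i = z₀ i) → ∀ j < J, w z j = w z₀ j := by
  have hU : IsOpen (⋂ j ∈ Finset.range J, (fun z => w z j) ⁻¹' {w z₀ j}) :=
    isOpen_biInter_finset fun j _ =>
      (isOpen_discrete _).preimage ((continuous_apply j).comp hw)
  obtain ⟨I, W, hW, hIW⟩ := isOpen_pi_iff.1 hU z₀ (by simp)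
  refine ⟨I.sup id + 1, fun z hz j hj => ?_⟩
  have : z ∈ ⋂ j ∈ Finset.range J, (fun z => w z j) ⁻¹' {w z₀ j} := hIW fun i hi => by
    rw [hz i (Nat.lt_succ_of_le (Finset.le_sup (f := id) hi))]
    exact (hW i hi).2
  exact mem_iInter₂.1 this j (Finset.mem_range.2 hj)

variable {d : FusionData}

theorem strictMono_coord (hd : ∀ k, d.Valid S w k) : StrictMono d.coord := fun i j hij =>
  (hd (j + 1)).2.1 i j hij (Nat.lt_succ_self j)

/-- Near the limit along `α`, the map `w` takes the values prescribed by a base point. -/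
theorem exists_approx_limit (hw : Continuous w) (α : Cantor) (J : ℕ) :
    ∃ K, ∀ k ≥ K, ∀ x ∈ d.approx w k, ∀ j < J, w (d.limit α) j =
      flipOn x (((Finset.range k).filter fun i => α i = true).image d.coord) j := by
  obtain ⟨K, hK⟩ := eventually_eq_of_agree hw (d.limit α) J
  refine ⟨K, fun k hk x hx j hj => ?_⟩
  obtain ⟨z, hz, hwz⟩ := hx.2 ((Finset.range k).filter fun i => α i = true)
    (Finset.filter_subset _ _)
  rw [← hwz, hK z (fun i hi => ?_) j hj]
  rw [hz i (hi.trans_le hk), limit]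
  congr 1
  ext l
  simp only [Finset.mem_inter, Finset.mem_filter, Finset.mem_range]
  constructor
  · tauto
  · rintro ⟨h1, h2⟩
    exact ⟨⟨by omega, h2⟩, h1⟩

theorem map_limit_eq (hd : ∀ k, d.Valid S w k) (hw : Continuous w) (α : Cantor) (j : ℕ) :
    w (d.limit α) j = true ↔
      w (d.limit fun _ => false) j = true ∨ ∃ i, α i = true ∧ d.coord i = j := by
  obtain ⟨K, hK⟩ := exists_approx_limit hw α (j + 1)
  obtain ⟨K', hK'⟩ := exists_approx_limit hw (fun _ => false) (j + 1)
  let k := max (max K K') (j + 1)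
  obtain ⟨x, hx⟩ := CtblColorable.nonempty_of_not (hd k).1
  rw [hK k (by omega) x hx j (by omega), hK' k (by omega) x hx j (by omega)]
  simp only [flipOn, Bool.or_eq_true, decide_eq_true_eq, Finset.mem_image, Finset.mem_filter,
    Finset.mem_range, Bool.false_eq_true, and_false, false_and, exists_const, or_false]
  refine or_congr_right ⟨fun ⟨i, h, hj⟩ => ⟨i, h.2, hj⟩, fun ⟨i, h, hj⟩ => ⟨i, ⟨?_, h⟩, hj⟩⟩
  have := (strictMono_coord hd).le_apply (x := i)
  omega

theorem map_limit_zero (hd : ∀ k, d.Valid S w k) (hw : Continuous w) (n : ℕ) :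
    w (d.limit fun _ => false) (d.coord n) = false ∧
      cardOnes (w (d.limit fun _ => false)) (d.coord n) = d.ones n := by
  obtain ⟨K, hK⟩ := exists_approx_limit hw (fun _ => false) (d.coord n + 1)
  obtain ⟨x, hx⟩ := CtblColorable.nonempty_of_not (hd (max K (n + 1))).1
  have hK' := hK _ (le_max_left _ _) x hx
  simp only [Bool.false_eq_true, Finset.filter_false, Finset.image_empty, flipOn_empty] at hK'
  rw [hK' _ (Nat.lt_succ_self _), cardOnes_congr fun i hi => hK' i (by omega)]
  exact hx.1 n (by omega)

theorem map_limit_coord (hd : ∀ k, d.Valid S w k) (hw : Continuous w) (α : Cantor) (n : ℕ) :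
    w (d.limit α) (d.coord n) = α n := by
  rw [Bool.eq_iff_iff, map_limit_eq hd hw, (map_limit_zero hd hw n).1]
  simp [(strictMono_coord hd).injective.eq_iff]

theorem map_limit_of_notMem (hd : ∀ k, d.Valid S w k) (hw : Continuous w) (α : Cantor)
    {j : ℕ} (hj : j ∉ range d.coord) :
    w (d.limit α) j = w (d.limit fun _ => false) j := by
  rw [Bool.eq_iff_iff, map_limit_eq hd hw]
  refine ⟨fun h => h.resolve_right fun ⟨i, _, hi⟩ => hj ⟨i, hi⟩, Or.inl⟩

theorem cardOnes_map_limit (hd : ∀ k, d.Valid S w k) (hw : Continuous w) (α : Cantor) (n : ℕ) :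
    cardOnes (w (d.limit α)) (d.coord n) = d.ones n + cardOnes α n := by
  let F := (Finset.range n).filter fun i => α i = true
  have h1 : cardOnes (w (d.limit α)) (d.coord n) =
      cardOnes (flipOn (w (d.limit fun _ => false)) (F.image d.coord)) (d.coord n) := by
    refine cardOnes_congr fun j hj => ?_
    rw [Bool.eq_iff_iff, map_limit_eq hd hw]
    simp only [flipOn, Bool.or_eq_true, decide_eq_true_eq, F, Finset.mem_image, Finset.mem_filter,
      Finset.mem_range]
    refine or_congr_right ⟨fun ⟨i, h, hi⟩ => ⟨i, ⟨?_, h⟩, hi⟩, fun ⟨i, h, hi⟩ => ⟨i, h.2, hi⟩⟩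
    rw [← hi] at hj
    exact (strictMono_coord hd).lt_iff_lt.1 hj
  rw [h1, cardOnes_flipOn, (map_limit_zero hd hw n).2,
    Finset.card_image_of_injective _ (strictMono_coord hd).injective, cardOnes_eq]
  · intro j hj
    obtain ⟨i, hi, rfl⟩ := Finset.mem_image.1 hj
    exact strictMono_coord hd (Finset.mem_range.1 (Finset.mem_filter.1 hi).1)
  · intro j hj
    obtain ⟨i, hi, rfl⟩ := Finset.mem_image.1 hj
    exact (map_limit_zero hd hw i).1

theorem cardOnes_map_limit_mem (hd : ∀ k, d.Valid S w k) (hw : Continuous w) (α : Cantor) (n : ℕ) :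
    cardOnes (w (d.limit α)) (d.coord n) ∈ S ↔ cardOnes α n ∈ S := by
  rw [cardOnes_map_limit hd hw]
  exact ((hd (n + 1)).2.2 n (Nat.lt_succ_self n) _ (cardOnes_le α n)).symm

theorem mem_ASet_map_limit (hd : ∀ k, d.Valid S w k) (hw : Continuous w) (α β : Cantor) :
    (w (d.limit α), w (d.limit β)) ∈ ASet S ↔ (α, β) ∈ ASet S := by
  have hinj := (strictMono_coord hd).injective
  rw [mem_ASet, mem_ASet]
  constructor
  · rintro ⟨N, h1, h2, h3⟩
    have hN : N ∈ range d.coord := by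
      by_contra hN
      have := congrFun h3 N
      rw [map_limit_of_notMem hd hw β hN, ← map_limit_of_notMem hd hw α hN, h1] at this
      simp [fSfun] at this
    obtain ⟨n, rfl⟩ := hN
    refine ⟨n, ?_, (cardOnes_map_limit_mem hd hw α n).1 h2, ?_⟩
    · rwa [map_limit_coord hd hw] at h1
    · ext i
      have := congrFun h3 (d.coord i)
      by_cases hin : i = n
      · subst hin
        rw [map_limit_coord hd hw] at this
        simpa [fSfun] using this
      · simpa [fSfun, hin, map_limit_coord hd hw, hinj.eq_iff] using this
  · rintro ⟨n, h1, h2, rfl⟩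
    refine ⟨d.coord n, by rwa [map_limit_coord hd hw],
      (cardOnes_map_limit_mem hd hw α n).2 h2, ?_⟩
    ext j
    by_cases hj : j ∈ range d.coord
    · obtain ⟨i, rfl⟩ := hj
      rw [map_limit_coord hd hw]
      by_cases hin : i = n
      · subst hin
        simp [fSfun]
      · simp [fSfun, hin, map_limit_coord hd hw, hinj.eq_iff]
    · have hjn : j ≠ d.coord n := fun h => hj ⟨n, h.symm⟩
      rw [map_limit_of_notMem hd hw _ hj, fSfun, Function.update_of_ne hjn,
        map_limit_of_notMem hd hw α hj]

end FusionData

theorem redRC_of_not_ctblColorable {S : Set ℕ} (hM : CondM S) {X Y : Type}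
    [tX : TopologicalSpace X] [PolishSpace X] [tY : TopologicalSpace Y] [PolishSpace Y]
    {u : X → Cantor} {v : Y → Cantor} (hu : Continuous u) (hv : Continuous v)
    (h : ¬ CtblColorable S (range u ∩ range v)) :
    RedRC inferInstance inferInstance tX tY (ASet S)
      ((fun p : X × Y => (u p.1, v p.2)) ⁻¹' ASet S) := by
  let Z := {p : X × Y | u p.1 = v p.2}
  have hZ : IsClosed Z := isClosed_eq (hu.comp continuous_fst) (hv.comp continuous_snd)
  have : PolishSpace Z := hZ.polishSpace
  obtain ⟨_, ⟨x, rfl⟩, ⟨y, hxy⟩⟩ := CtblColorable.nonempty_of_not h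
  have : Nonempty Z := ⟨⟨(x, y), hxy.symm⟩⟩
  obtain ⟨e, he, hes⟩ := PolishSpace.exists_nat_nat_continuous_surjective Z
  let w : (ℕ → ℕ) → Cantor := fun z => u (e z).1.1
  have hw : Continuous w :=
    hu.comp (continuous_fst.comp (continuous_subtype_val.comp he))
  have hw' : ∀ z, v (e z).1.2 = w z := fun z => (e z).2.symm
  have hrange : ¬ CtblColorable S (range w) := fun hc => h (hc.mono (by
    rintro _ ⟨⟨x, rfl⟩, ⟨y, hy⟩⟩
    obtain ⟨z, hz⟩ := hes ⟨(x, y), hy.symm⟩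
    exact ⟨z, by simp [w, hz]⟩))
  obtain ⟨d, hd⟩ := FusionData.exists_forall_valid hM hw hrange
  have hg : Continuous fun α => (e (d.limit α)).1 :=
    continuous_subtype_val.comp (he.comp d.continuous_limit)
  refine ⟨fun α => (e (d.limit α)).1.1, fun α => (e (d.limit α)).1.2, continuous_fst.comp hg,
    continuous_snd.comp hg, ?_⟩
  ext ⟨α, β⟩
  simp only [mem_preimage, hw']
  exact (FusionData.mem_ASet_map_limit hd hw α β).symm

theorem stmt11 (S : Set ℕ) (hinf : S.Infinite) (h0 : 0 ∈ S) (hM : CondM S) :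
    CondH S ∧ MinNonPotClosed inferInstance inferInstance (ASet S) := by
  refine ⟨hM.condH h0, not_potClosed_ASet hinf, ?_⟩
  rintro X Y tX tY hX hY A' - hA' ⟨u, v, hu, hv, rfl⟩
  exact redRC_of_not_ctblColorable hM hu hv fun h => hA' (potClosed_of_ctblColorable hu hv h)
end

section
/- Let (X,(f_n)) and (X',(f'_n)) be converging situations, and let u, v : X → X' be continuous maps such that A^f = (u×v)⁻¹(A^{f'}). Then u = v. -/
open Set Topology

theorem stmt13 {X X' : Type} (t : TopologicalSpace X) (t' : TopologicalSpace X')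
    (D : ℕ → Set X) (f : ℕ → X → X) (D' : ℕ → Set X') (f' : ℕ → X' → X')
    (h : ConvSit X t D f) (h' : ConvSit X' t' D' f')
    (u v : X → X') (hu : @Continuous X X' t t' u) (hv : @Continuous X X' t t' v)
    (heq : unionGraphs D f = (fun p : X × X => (u p.1, v p.2)) ⁻¹' unionGraphs D' f') :
    u = v := by
  obtain ⟨-, -, -, -, -, hΔ⟩ := h
  obtain ⟨-, -, -, -, -, hΔ'⟩ := h'
  funext x
  obtain ⟨hcl, hnot⟩ := hΔ.subset (mem_diagonal x)
  have hmaps : MapsTo (fun p : X × X => (u p.1, v p.2))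
      (unionGraphs D f) (unionGraphs D' f') := fun _ hp => heq.subset hp
  exact hΔ'.superset
    ⟨hmaps.closure ((hu.comp continuous_fst).prodMk (hv.comp continuous_snd)) hcl,
      fun hx => hnot (heq.superset hx)⟩
end

section
/- Let S, S' ⊆ ω be infinite, contain 0, and satisfy condition (M). (a) If there is p ∈ ω such that for all c ∈ ω, c + (S ∩ [0,p]) ≠ S' ∩ (c + [0,p]) (condition (⊥)), then A^S ⊥ʳ_c A^{S'}. (b) If there is p ∈ ω such that for all c ∈ ω, c − (S ∩ [0,p]) ≠ S' ∩ (c − [0,p]) (condition (⊥⁻¹)), then A^S ⊥ʳ_c (A^{S'})⁻¹. -/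
open Set Topology

theorem cardOnes_update_of_le {x : Cantor} {j m : ℕ} (h : m ≤ j) (b : Bool) :
    cardOnes (Function.update x j b) m = cardOnes x m :=
  cardOnes_congr fun _ hi => Function.update_of_ne (by omega) _ _

theorem cardOnes_update_true {x : Cantor} {j m : ℕ} (h : j < m) (hx : x j = false) :
    cardOnes (Function.update x j true) m = cardOnes x m + 1 := by
  have hj : j ∈ Finset.range m := Finset.mem_range.2 h
  unfold cardOnes
  rw [← Finset.add_sum_erase _ _ hj, ← Finset.add_sum_erase (Finset.range m) _ hj]
  have : ∀ i ∈ (Finset.range m).erase j,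
      (if Function.update x j true i then 1 else 0) = if x i then 1 else 0 := by
    intro i hi
    rw [Function.update_of_ne (Finset.ne_of_mem_erase hi)]
  rw [Finset.sum_congr rfl this]
  simp [hx, add_comm]

theorem cardOnes_update_false {x : Cantor} {j m : ℕ} (h : j < m) (hx : x j = true) :
    cardOnes (Function.update x j false) m + 1 = cardOnes x m := by
  have := cardOnes_update_true (x := Function.update x j false) h (by simp)
  rw [← this, Function.update_idem, ← hx, Function.update_eq_self]

/-- The sequence `y` is obtained from `x` by flipping coordinate `m` from `d` to `!d`. -/
def Flip (d : Bool) (x : Cantor) (m : ℕ) (y : Cantor) : Prop :=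
  x m = d ∧ y = Function.update x m (!d)

theorem Flip.ne {d : Bool} {x y : Cantor} {m : ℕ} (h : Flip d x m y) : x m ≠ y m := by
  rw [h.2, Function.update_self, h.1]; simp

theorem Flip.eq_of_ne {d : Bool} {x y : Cantor} {m i : ℕ} (h : Flip d x m y) (hi : i ≠ m) :
    y i = x i := by
  rw [h.2, Function.update_of_ne hi]

theorem Flip.index_eq {d : Bool} {x y : Cantor} {m i : ℕ} (h : Flip d x m y) (hi : x i ≠ y i) :
    i = m := by
  by_contra hne
  exact hi (h.eq_of_ne hne).symm

theorem Flip.symm {d : Bool} {x y : Cantor} {m : ℕ} (h : Flip d x m y) : Flip (!d) y m x := by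
  refine ⟨by rw [h.2, Function.update_self], ?_⟩
  rw [h.2, Function.update_idem, Bool.not_not, ← h.1, Function.update_eq_self]

theorem Flip.transport {d e : Bool} {a b a' b' : Cantor} {j m : ℕ} (hjm : j ≠ m)
    (ha : Flip d a j a') (hb : Flip d b j b') (h : Flip e a m b) : Flip e a' m b' := by
  refine ⟨by rw [ha.eq_of_ne hjm.symm, h.1], ?_⟩
  rw [hb.2, ha.2, h.2, Function.update_comm hjm]

theorem Flip.cardOnes_eq {d : Bool} {x y : Cantor} {j m : ℕ} (h : Flip d x j y) (hjm : j < m) :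
    (cardOnes y m : ℤ) = cardOnes x m + if d then -1 else 1 := by
  cases d
  · have := cardOnes_update_true hjm h.1
    rw [h.2]
    simp [this]
  · have := cardOnes_update_false hjm h.1
    rw [h.2]
    simp only [Bool.not_true, if_true]
    omega

/-- The set `A^S` for `d = false`, its inverse for `d = true`. -/
def flipRel (d : Bool) (S : Set ℕ) : Set (Cantor × Cantor) :=
  {p | ∃ m, Flip d p.1 m p.2 ∧ cardOnes p.1 m ∈ S}

theorem aSet_eq_flipRel (S : Set ℕ) : ASet S = flipRel false S := by
  ext ⟨x, y⟩
  simp only [ASet, unionGraphs, graphRel, DSdom, fSfun, flipRel, Flip, mem_iUnion, mem_ofPred_eq,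
    Bool.not_false]
  exact exists_congr fun m => by tauto

theorem Flip.cardOnes_self {d : Bool} {x y : Cantor} {m : ℕ} (h : Flip d x m y) :
    cardOnes y m = cardOnes x m := by
  rw [h.2, cardOnes_update_of_le le_rfl]

theorem invRel_aSet_eq_flipRel (S : Set ℕ) : invRel (ASet S) = flipRel true S := by
  rw [aSet_eq_flipRel]
  ext ⟨x, y⟩
  constructor
  · rintro ⟨m, h, hS⟩
    exact ⟨m, h.symm, by rwa [h.cardOnes_self]⟩
  · rintro ⟨m, h, hS⟩
    exact ⟨m, h.symm, show cardOnes y m ∈ S by rwa [h.cardOnes_self]⟩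

theorem exists_modulus {f : Cantor → Cantor} (hf : Continuous f) (x : Cantor) (M : ℕ) :
    ∃ L, ∀ y : Cantor, (∀ i < L, y i = x i) → ∀ i < M, f y i = f x i := by
  have hU : IsOpen {y : Cantor | ∀ i ∈ Finset.range M, f y i = f x i} := by
    have : {y : Cantor | ∀ i ∈ Finset.range M, f y i = f x i} =
        ⋂ i ∈ Finset.range M, (fun y => f y i) ⁻¹' {f x i} := by
      ext y; simp
    rw [this]
    exact isOpen_biInter_finset fun i _ =>
      (isOpen_discrete _).preimage ((continuous_apply i).comp hf)
  obtain ⟨I, V, hV, hsub⟩ := isOpen_pi_iff.1 hU x (fun i _ => rfl)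
  refine ⟨I.sup id + 1, fun y hy i hi => ?_⟩
  refine hsub (fun j hj => ?_) i (Finset.mem_range.2 hi)
  rw [hy j (Nat.lt_succ_of_le (Finset.le_sup (f := id) hj))]
  exact (hV j hj).2

/-- The sequence with the first `n` coordinates of `w`, and the other coordinates of `t`. -/
def graft (n : ℕ) (w t : Cantor) : Cantor := fun i => if i < n then w i else t i

theorem graft_of_lt {n i : ℕ} (h : i < n) (w t : Cantor) : graft n w t i = w i := if_pos h

theorem graft_congr {n : ℕ} {w w' : Cantor} (h : ∀ i < n, w i = w' i) (t : Cantor) :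
    graft n w t = graft n w' t := by
  funext i
  unfold graft
  split_ifs with hi
  · exact h i hi
  · rfl

theorem graft_update {n k : ℕ} (h : k < n) (w t : Cantor) (b : Bool) :
    graft n (Function.update w k b) t = Function.update (graft n w t) k b := by
  funext i
  by_cases hi : i = k
  · subst hi; simp [graft, h]
  · simp [graft, Function.update_of_ne hi]

/-- The sequence `1^N 0^∞`. -/
def onesUpTo (N : ℕ) : Cantor := fun i => decide (i < N)

theorem cardOnes_graft_onesUpTo (n N : ℕ) (w : Cantor) :
    cardOnes (graft n w (onesUpTo (n + N))) (n + N) = cardOnes w n + N := by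
  unfold cardOnes
  rw [Finset.sum_range_add]
  congr 1
  · exact Finset.sum_congr rfl fun i hi => by rw [graft_of_lt (Finset.mem_range.1 hi)]
  · rw [Finset.sum_congr rfl (g := fun _ => 1)]
    · simp
    · intro i hi
      have := Finset.mem_range.1 hi
      simp [graft, onesUpTo, this]

theorem flip_graft_onesUpTo (n N : ℕ) (w : Cantor) :
    Flip false (graft n w (onesUpTo (n + N))) (n + N) (graft n w (onesUpTo (n + (N + 1)))) := by
  refine ⟨by simp [graft, onesUpTo], ?_⟩
  funext i
  by_cases hi : i = n + N
  · subst hi; simp [graft, onesUpTo]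
  · rw [Function.update_of_ne hi]
    simp only [graft, onesUpTo]
    congr 2
    simp only [eq_iff_iff]
    omega

theorem graft_onesUpTo_mem_iff {S : Set ℕ} (n N : ℕ) (w : Cantor) :
    (graft n w (onesUpTo (n + N)), graft n w (onesUpTo (n + (N + 1)))) ∈ flipRel false S ↔
      cardOnes w n + N ∈ S := by
  rw [← cardOnes_graft_onesUpTo]
  have hf := flip_graft_onesUpTo n N w
  constructor
  · rintro ⟨m, h, hS⟩
    rwa [hf.index_eq h.ne] at hS
  · exact fun hS => ⟨_, hf, hS⟩

/-- If `0 ∈ S`, the edges of `A^S` at coordinates below `n` connect any two sequences which agree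
from coordinate `n` on. -/
theorem iff_of_edge_invariant {S : Set ℕ} (h0 : 0 ∈ S) {P : Cantor → Prop} (n : ℕ)
    (hP : ∀ k < n, ∀ x : Cantor, x k = false → cardOnes x k ∈ S →
      (P x ↔ P (Function.update x k true)))
    {x y : Cantor} (hxy : ∀ i, n ≤ i → x i = y i) : P x ↔ P y := by
  induction n generalizing x y with
  | zero => rw [funext fun i => hxy i (Nat.zero_le i)]
  | succ n ih =>
    have ih' : ∀ {x y : Cantor}, (∀ i, n ≤ i → x i = y i) → (P x ↔ P y) :=
      ih fun k hk => hP k (by omega)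
    have key : ∀ {x y : Cantor}, (∀ i, n + 1 ≤ i → x i = y i) → x n = false → y n = true →
        (P x ↔ P y) := by
      intro x y hxy hx hy
      have h1 : P x ↔ P (graft n (fun _ => false) x) :=
        ih' fun i hi => by simp [graft, Nat.not_lt.2 hi]
      have h2 := hP n (Nat.lt_succ_self n) (graft n (fun _ => false) x) (by simpa [graft] using hx)
        (by
          rw [cardOnes_congr (y := fun _ => false) fun i hi => graft_of_lt hi _ _]
          simpa [cardOnes] using h0)
      rw [h1, h2]
      refine ih' fun i hi => ?_
      by_cases hin : i = n
      · subst hin; simp [hy]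
      · rw [Function.update_of_ne hin, ← hxy i (by omega)]
        simp [graft, Nat.not_lt.2 hi]
    by_cases hn : x n = y n
    · refine ih' fun i hi => ?_
      rcases Nat.eq_or_lt_of_le hi with rfl | hi
      · exact hn
      · exact hxy i hi
    · cases hx : x n <;> cases hy : y n
      · simp [hx, hy] at hn
      · exact key hxy hx hy
      · exact (key (fun i hi => (hxy i hi).symm) hy hx).symm
      · simp [hx, hy] at hn

/-- The two components of a reduction of `A^S` coincide, because the diagonal is contained in the
closure of `A^S` and disjoint from it. -/
theorem reduction_components_eq {d : Bool} {S S' : Set ℕ} (hinf : S.Infinite)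
    {u v : Cantor → Cantor} (hu : Continuous u) (hv : Continuous v)
    (h : ∀ x y, (x, y) ∈ flipRel false S ↔ (u x, v y) ∈ flipRel d S') : u = v := by
  funext x
  by_contra hne
  obtain ⟨i, hi⟩ := Function.ne_iff.1 hne
  have approx : ∀ M, i < M → ∃ a b : Cantor, Flip d a i b ∧ cardOnes a i ∈ S' ∧
      (∀ j < M, a j = u x j) ∧ ∀ j < M, b j = v x j := by
    intro M hM
    obtain ⟨L₁, hL₁⟩ := exists_modulus hu x M
    obtain ⟨L₂, hL₂⟩ := exists_modulus hv x M
    set L := max L₁ L₂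
    obtain ⟨s, hs, hsl⟩ := hinf.exists_gt (cardOnes x L)
    obtain ⟨N, rfl⟩ := Nat.exists_eq_add_of_le hsl.le
    obtain ⟨m, hm, hmS⟩ := (h _ _).1 ((graft_onesUpTo_mem_iff L N x).2 hs)
    have ha : ∀ j < M, u (graft L x (onesUpTo (L + N))) j = u x j :=
      hL₁ _ fun j hj => graft_of_lt (hj.trans_le (le_max_left _ _)) _ _
    have hb : ∀ j < M, v (graft L x (onesUpTo (L + (N + 1)))) j = v x j :=
      hL₂ _ fun j hj => graft_of_lt (hj.trans_le (le_max_right _ _)) _ _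
    have him : i = m := hm.index_eq (by
      show u _ i ≠ v _ i
      rw [ha i hM, hb i hM]; exact hi)
    subst him
    exact ⟨_, _, hm, hmS, ha, hb⟩
  have hmem : (u x, v x) ∈ flipRel d S' := by
    obtain ⟨a, b, hab, hS, ha, hb⟩ := approx (i + 1) (Nat.lt_succ_self i)
    refine ⟨i, ⟨by rw [← hab.1, ha i (Nat.lt_succ_self i)], ?_⟩, ?_⟩
    · funext j
      obtain ⟨a, b, hab, -, ha, hb⟩ := approx (i + j + 1) (by omega)
      show v x j = _
      rw [← hb j (by omega), hab.2]
      by_cases hj : j = i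
      · subst hj; simp
      · rw [Function.update_of_ne hj, Function.update_of_ne hj, ha j (by omega)]
    · rwa [cardOnes_congr fun j hj => (ha j (by omega)).symm]
  obtain ⟨m, hm, -⟩ := (h x x).2 hmem
  exact hm.ne rfl

theorem exists_bound_of_graft {n : ℕ} {Φ : Cantor → Cantor → ℕ → Prop}
    (hmono : ∀ w w' M M', M ≤ M' → Φ w w' M → Φ w w' M')
    (hcongr : ∀ w w' z z' M, (∀ i < n, w i = z i) → (∀ i < n, w' i = z' i) →
      Φ w w' M → Φ z z' M)
    (hex : ∀ w w', ∃ M, Φ w w' M) : ∃ M, ∀ w w', Φ w w' M := by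
  choose B hB using hex
  let ext : (Fin n → Bool) → Cantor := fun w i => if h : i < n then w ⟨i, h⟩ else false
  let g : (Fin n → Bool) × (Fin n → Bool) → ℕ := fun q => B (ext q.1) (ext q.2)
  refine ⟨Finset.univ.sup g, fun w w' => ?_⟩
  have hext : ∀ w : Cantor, ∀ i < n, ext (fun j : Fin n => w j) i = w i := by
    intro w i hi; simp [ext, hi]
  refine hcongr _ _ _ _ _ (hext w) (hext w') (hmono _ _ _ _ ?_ (hB _ _))
  exact Finset.le_sup (f := g) (Finset.mem_univ (fun j : Fin n => w j, fun j : Fin n => w' j))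

theorem exists_separating_bound (u : Cantor → Cantor) (n : ℕ) (t : Cantor) :
    ∃ M, ∀ w w', u (graft n w t) ≠ u (graft n w' t) →
      ∃ i < M, u (graft n w t) i ≠ u (graft n w' t) i := by
  refine exists_bound_of_graft (n := n) ?_ ?_ ?_
  · intro w w' M M' hM h hne
    obtain ⟨i, hi, h⟩ := h hne
    exact ⟨i, hi.trans_le hM, h⟩
  · intro w w' z z' M hw hw' h
    rwa [graft_congr hw, graft_congr hw'] at h
  · intro w w'
    by_cases hne : u (graft n w t) = u (graft n w' t)
    · exact ⟨0, fun h => absurd hne h⟩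
    · obtain ⟨i, hi⟩ := Function.ne_iff.1 hne
      exact ⟨i + 1, fun _ => ⟨i, Nat.lt_succ_self i, hi⟩⟩

theorem exists_uniform_modulus {u : Cantor → Cantor} (hu : Continuous u) (n M : ℕ) :
    ∃ K, ∀ w N, K ≤ N → ∀ i < M,
      u (graft n w (onesUpTo (n + N))) i = u (graft n w fun _ => true) i := by
  obtain ⟨K, hK⟩ := exists_bound_of_graft (n := n) (Φ := fun w _ K => ∀ N, K ≤ N → ∀ i < M,
      u (graft n w (onesUpTo (n + N))) i = u (graft n w fun _ => true) i)
    (fun w _ K K' hK h N hN => h N (hK.trans hN))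
    (fun w w' z z' K hw _ h => by simpa only [graft_congr hw] using h)
    (fun w _ => by
      obtain ⟨L, hL⟩ := exists_modulus hu (graft n w fun _ => true) M
      refine ⟨L, fun N hN => hL _ fun i hi => ?_⟩
      simp [graft, onesUpTo, show i < n + N by omega])
  exact ⟨K, fun w => hK w w⟩

/-- A reduction of `A^S` to `A^{S'}` (or to its inverse) matches arbitrarily long windows of `S`
with translated (or reflected) windows of `S'`. -/
theorem exists_matching_windows {d : Bool} {S S' : Set ℕ} (hinf : S.Infinite) (h0 : 0 ∈ S)
    (hred : RedC2 (ASet S) (flipRel d S')) (n : ℕ) :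
    ∃ (c : ℕ) (κ : ℕ → ℕ), ∀ i ≤ n,
      (κ i : ℤ) = κ 0 + (if d then -1 else 1) * i ∧ (c + i ∈ S ↔ κ i ∈ S') := by
  obtain ⟨u, v, hu, hv, heq⟩ := hred
  rw [aSet_eq_flipRel] at heq
  have h : ∀ x y, (x, y) ∈ flipRel false S ↔ (u x, v y) ∈ flipRel d S' := by
    intro x y; rw [heq]; rfl
  obtain rfl := reduction_components_eq hinf hu hv h
  obtain ⟨M, hM⟩ := exists_separating_bound u n fun _ => true
  obtain ⟨K, hK⟩ := exists_uniform_modulus hu n M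
  obtain ⟨N, hNS, hKN⟩ := hinf.exists_gt K
  let a : Cantor → Cantor := fun w => u (graft n w (onesUpTo (n + N)))
  let b : Cantor → Cantor := fun w => u (graft n w (onesUpTo (n + (N + 1))))
  have ha : ∀ w, ∀ i < M, a w i = u (graft n w fun _ => true) i := fun w => hK w N hKN.le
  have hb : ∀ w, ∀ i < M, b w i = u (graft n w fun _ => true) i := fun w => hK w _ (by omega)
  have hzero : cardOnes (fun _ => false) n = 0 := by simp [cardOnes]
  obtain ⟨m, hm, -⟩ : (a fun _ => false, b fun _ => false) ∈ flipRel d S' :=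
    (h _ _).1 ((graft_onesUpTo_mem_iff n N _).2 (by rwa [hzero, zero_add]))
  have hMm : M ≤ m := by
    by_contra hlt
    exact hm.ne (by
      show a _ m = b _ m
      rw [ha _ _ (by omega), hb _ _ (by omega)])
  have edge : ∀ k < n, ∀ w : Cantor, w k = false → cardOnes w k ∈ S →
      ∃ j < m, Flip d (a w) j (a (Function.update w k true)) ∧
        Flip d (b w) j (b (Function.update w k true)) := by
    intro k hk w hwk hwS
    have hflip : ∀ t, ∃ j, Flip d (u (graft n w t)) j (u (graft n (Function.update w k true) t)) := by
      intro t
      obtain ⟨j, hj, -⟩ := (h (graft n w t) (graft n (Function.update w k true) t)).1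
        ⟨k, ⟨(graft_of_lt hk w t).trans hwk, graft_update hk w t true⟩, by
          rwa [cardOnes_congr fun i hi => graft_of_lt (hi.trans hk) w t]⟩
      exact ⟨j, hj⟩
    obtain ⟨j₀, hj₀⟩ := hflip fun _ => true
    obtain ⟨i, hiM, hi⟩ := hM w (Function.update w k true) fun e => hj₀.ne (by rw [e])
    obtain ⟨j, hj⟩ := hflip (onesUpTo (n + N))
    obtain ⟨j', hj'⟩ := hflip (onesUpTo (n + (N + 1)))
    have e : i = j := hj.index_eq (by
      show a _ i ≠ a _ i
      rwa [ha _ _ hiM, ha _ _ hiM])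
    have e' : i = j' := hj'.index_eq (by
      show b _ i ≠ b _ i
      rwa [hb _ _ hiM, hb _ _ hiM])
    subst e e'
    exact ⟨i, hiM.trans_le hMm, hj, hj'⟩
  let C := cardOnes (a fun _ => false) m
  let P : Cantor → Prop := fun w => Flip d (a w) m (b w) ∧
    (cardOnes (a w) m : ℤ) = C + (if d then -1 else 1) * cardOnes w n
  have hP : ∀ w : Cantor, (∀ i, n ≤ i → w i = false) → P w := by
    intro w hw
    refine (iff_of_edge_invariant h0 n ?_ (x := fun _ => false) fun i hi => (hw i hi).symm).1
      ⟨hm, by simp [C, hzero]⟩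
    intro k hk w hwk hwS
    obtain ⟨j, hjm, hj, hj'⟩ := edge k hk w hwk hwS
    have hcard := hj.cardOnes_eq hjm
    have hcard' := cardOnes_update_true hk hwk
    refine and_congr ⟨hj.transport hjm.ne hj', hj.symm.transport hjm.ne hj'.symm⟩ ?_
    rw [hcard, hcard']
    push_cast
    rw [mul_add, mul_one, ← add_assoc]
    exact (add_left_inj _).symm
  have hcard : ∀ i ≤ n, cardOnes (onesUpTo i) n = i := by
    intro i hi
    simp only [cardOnes, onesUpTo, decide_eq_true_eq, Finset.sum_boole, Nat.cast_id]
    rw [show (Finset.range n).filter (· < i) = Finset.range i by ext; simp; omega,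
      Finset.card_range]
  have hones : ∀ i ≤ n, P (onesUpTo i) := fun i hi => hP _ fun j hj => by
    simp [onesUpTo]; omega
  have hones0 : onesUpTo 0 = fun _ => false := by funext i; simp [onesUpTo]
  refine ⟨N, fun i => cardOnes (a (onesUpTo i)) m, fun i hi => ⟨?_, ?_⟩⟩
  · show (cardOnes (a (onesUpTo i)) m : ℤ) = cardOnes (a (onesUpTo 0)) m + _
    rw [(hones i hi).2, hcard i hi, hones0]
  · have hf := (hones i hi).1
    have key := graft_onesUpTo_mem_iff (S := S) n N (onesUpTo i)
    rw [hcard i hi, add_comm i] at key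
    rw [← key, h]
    constructor
    · rintro ⟨m', hm', hS⟩
      rwa [show m = m' from hm'.index_eq hf.ne]
    · exact fun hS => ⟨m, hf, hS⟩

theorem exists_translated_window {S S' : Set ℕ} (hinf : S.Infinite) (h0 : 0 ∈ S)
    (hred : RedC2 (ASet S) (ASet S')) (n : ℕ) :
    ∃ c c' : ℕ, ∀ i ≤ n, (c + i ∈ S ↔ c' + i ∈ S') := by
  rw [aSet_eq_flipRel S'] at hred
  obtain ⟨c, κ, h⟩ := exists_matching_windows hinf h0 hred n
  refine ⟨c, κ 0, fun i hi => ?_⟩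
  obtain ⟨h1, h2⟩ := h i hi
  rwa [show κ 0 + i = κ i by simp at h1; omega]

theorem exists_reflected_window {S S' : Set ℕ} (hinf : S.Infinite) (h0 : 0 ∈ S)
    (hred : RedC2 (ASet S) (invRel (ASet S'))) (n : ℕ) :
    ∃ c c' : ℕ, n ≤ c' ∧ ∀ i ≤ n, (c + i ∈ S ↔ c' - i ∈ S') := by
  rw [invRel_aSet_eq_flipRel] at hred
  obtain ⟨c, κ, h⟩ := exists_matching_windows hinf h0 hred n
  refine ⟨c, κ 0, ?_, fun i hi => ?_⟩
  · have := (h n le_rfl).1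
    simp at this
    omega
  · obtain ⟨h1, h2⟩ := h i hi
    rwa [show κ 0 - i = κ i by simp at h1; omega]

theorem RedC2.swap {A B : Set (Cantor × Cantor)} (h : RedC2 A B) :
    RedC2 (invRel A) (invRel B) := by
  obtain ⟨u, v, hu, hv, rfl⟩ := h
  exact ⟨v, u, hv, hu, rfl⟩

theorem CondM.exists_copy {S : Set ℕ} (hM : CondM S) (p : ℕ) :
    ∃ k, ∀ q, ∃ e ≤ k, ∀ i ≤ p, (i ∈ S ↔ q + e + i ∈ S) := by
  obtain ⟨k, hk⟩ := hM p
  refine ⟨k, fun q => ?_⟩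
  obtain ⟨c, hqc, hck, h⟩ := hk q
  refine ⟨c - q, by omega, fun i hi => ?_⟩
  rw [show q + (c - q) = c by omega]
  constructor
  · intro hiS
    exact (h.subset ⟨i, ⟨hiS, hi⟩, rfl⟩).1
  · intro hiS
    obtain ⟨j, ⟨hj, -⟩, hji⟩ := h.superset ⟨hiS, by simp [hi]⟩
    rwa [← show j = i by simpa using hji]

theorem CondPerp.not_windows {S S' : Set ℕ} (hM : CondM S) (h : CondPerp S S') :
    ¬ ∀ n, ∃ c c' : ℕ, ∀ i ≤ n, (c + i ∈ S ↔ c' + i ∈ S') := by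
  intro hw
  obtain ⟨p, hp⟩ := h
  obtain ⟨k, hk⟩ := hM.exists_copy p
  obtain ⟨c, c', hc⟩ := hw (k + p)
  obtain ⟨e, hek, he⟩ := hk c
  have hiff : ∀ i ≤ p, (i ∈ S ↔ c' + e + i ∈ S') := fun i hi => by
    rw [he i hi, add_assoc, hc (e + i) (by omega), add_assoc]
  refine hp (c' + e) (Set.ext fun j => ⟨?_, ?_⟩)
  · rintro ⟨i, ⟨hiS, hip⟩, rfl⟩
    have hip : i ≤ p := hip
    exact ⟨(hiff i hip).1 hiS, by simp [hip]⟩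
  · rintro ⟨hj, hj1, hj2⟩
    obtain ⟨i, rfl⟩ := Nat.exists_eq_add_of_le hj1
    have hip : i ≤ p := by omega
    exact ⟨i, ⟨(hiff i hip).2 hj, hip⟩, rfl⟩

theorem CondPerpInv.not_windows {S S' : Set ℕ} (hM : CondM S) (h : CondPerpInv S S') :
    ¬ ∀ n, ∃ c c' : ℕ, n ≤ c' ∧ ∀ i ≤ n, (c + i ∈ S ↔ c' - i ∈ S') := by
  intro hw
  obtain ⟨p, hp⟩ := h
  obtain ⟨k, hk⟩ := hM.exists_copy p
  obtain ⟨c, c', hc', hc⟩ := hw (k + p)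
  obtain ⟨e, hek, he⟩ := hk c
  have hiff : ∀ i ≤ p, (i ∈ S ↔ c' - e - i ∈ S') := fun i hi => by
    rw [he i hi, add_assoc, hc (e + i) (by omega), Nat.sub_sub]
  refine hp (c' - e) (Set.ext fun j => ⟨?_, ?_⟩)
  · rintro ⟨i, ⟨hiS, hip⟩, rfl⟩
    have hip : i ≤ p := hip
    refine ⟨⟨_, (hiff i hip).1 hiS, ?_⟩, ?_, ?_⟩ <;> simp only [] <;> omega
  · rintro ⟨⟨l, hl, rfl⟩, hj1, hj2⟩
    simp only [] at hj1 hj2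
    have hip : c' - e - l ≤ p := by omega
    refine ⟨c' - e - l, ⟨(hiff _ hip).2 ?_, hip⟩, ?_⟩
    · rwa [show c' - e - (c' - e - l) = l by omega]
    · simp only []
      omega

theorem stmt14 (S S' : Set ℕ) (hinf : S.Infinite) (hinf' : S'.Infinite)
    (h0 : 0 ∈ S) (h0' : 0 ∈ S') (hM : CondM S) (hM' : CondM S') :
    (CondPerp S S' →
      ¬ RedC2 (ASet S) (ASet S') ∧ ¬ RedC2 (ASet S') (ASet S)) ∧
    (CondPerpInv S S' →
      ¬ RedC2 (ASet S) (invRel (ASet S')) ∧ ¬ RedC2 (invRel (ASet S')) (ASet S)) := by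
  refine ⟨fun h => ⟨fun hr => ?_, fun hr => ?_⟩, fun h => ⟨fun hr => ?_, fun hr => ?_⟩⟩
  · exact h.not_windows hM (exists_translated_window hinf h0 hr)
  · refine h.not_windows hM fun n => ?_
    obtain ⟨c, c', hc⟩ := exists_translated_window hinf' h0' hr n
    exact ⟨c', c, fun i hi => (hc i hi).symm⟩
  · exact h.not_windows hM (exists_reflected_window hinf h0 hr)
  · refine h.not_windows hM fun n => ?_
    obtain ⟨c, c', hc', hc⟩ := exists_reflected_window hinf' h0' hr.swap n
    refine ⟨c' - n, c + n, by omega, fun i hi => ?_⟩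
    have := hc (n - i) (by omega)
    rw [show c' - n + i = c' - (n - i) by omega, show c + n - i = c + (n - i) by omega]
    exact this.symm
end
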